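/- arXiv:1402.1582 — 4 statements merged into one kernel-verified Lean document; each statement's English description precedes it below -/
import Mathlib

section
/- Let β be a quadratic Pisot unit and let m ∈ ℕ with m > β − 1. Then there exist Δ₁, Δ₂ > 0 such that, up to finitely many exceptions, the distances y_{k+1} − y_k between consecutive points of the spectrum X^m(β) (enumerated increasingly as 0 = y₀ < y₁ < y₂ < ⋯) take values in the set {Δ₁, Δ₂, Δ₁ + Δ₂}; i.e. there exists N ∈ ℕ such that y_{k+1} − y_k ∈ {Δ₁, Δ₂, Δ₁ + Δ₂} for all k ≥ N. -/
/-- The spectrum `X^m(β)`: sums `∑_{j=0}^n a_j β^j` with digits `a_j ∈ {0,1,…,m}`. -/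
def Xspec (β : ℝ) (m : ℕ) : Set ℝ :=
  {x | ∃ (n : ℕ) (c : ℕ → ℕ), (∀ j ≤ n, c j ≤ m) ∧
    x = ∑ j ∈ Finset.range (n + 1), (c j : ℝ) * β ^ j}

/-- The pair `(x, x')` is the canonical embedding of an element `i + jβ` of `ℤ[β]`,
where `γ` is the conjugate of `β`. -/
def IsConjPair (β γ x x' : ℝ) : Prop :=
  ∃ i j : ℤ, x = i + j * β ∧ x' = i + j * γ

/-- All sufficiently large elements of `ℤ[β]` whose conjugate lies well inside the window
`(l, r)` belong to the spectrum. -/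
def FillsWindow (β γ l r : ℝ) (m : ℕ) : Prop :=
  ∀ ε > 0, ∃ R : ℝ, ∀ x x', IsConjPair β γ x x' → R ≤ x → l + ε ≤ x' → x' ≤ r - ε →
    x ∈ Xspec β m

namespace IsConjPair

variable {β γ x x' y y' : ℝ}

theorem add (hx : IsConjPair β γ x x') (hy : IsConjPair β γ y y') :
    IsConjPair β γ (x + y) (x' + y') := by
  obtain ⟨i, j, rfl, rfl⟩ := hx
  obtain ⟨k, l, rfl, rfl⟩ := hy
  exact ⟨i + k, j + l, by push_cast; ring, by push_cast; ring⟩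

theorem sub (hx : IsConjPair β γ x x') (hy : IsConjPair β γ y y') :
    IsConjPair β γ (x - y) (x' - y') := by
  obtain ⟨i, j, rfl, rfl⟩ := hx
  obtain ⟨k, l, rfl, rfl⟩ := hy
  exact ⟨i - k, j - l, by push_cast; ring, by push_cast; ring⟩

theorem natCast (a : ℕ) : IsConjPair β γ a a := ⟨a, 0, by simp, by simp⟩

theorem base : IsConjPair β γ β γ := ⟨0, 1, by simp, by simp⟩

theorem mul_base {p s : ℤ} (hβ : β ^ 2 = p * β + s) (hγ : γ ^ 2 = p * γ + s)
    (hx : IsConjPair β γ x x') : IsConjPair β γ (β * x) (γ * x') := by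
  obtain ⟨i, j, rfl, rfl⟩ := hx
  refine ⟨s * j, i + p * j, ?_, ?_⟩ <;> push_cast
  · linear_combination j * hβ
  · linear_combination j * hγ

theorem exists_eq_add_mul {p s : ℤ} (hs : s * s = 1) (hβ : β ^ 2 = p * β + s)
    (hγ : γ ^ 2 = p * γ + s) (hx : IsConjPair β γ x x') (a : ℤ) :
    ∃ y y', IsConjPair β γ y y' ∧ x = a + β * y ∧ x' = a + γ * y' := by
  obtain ⟨i, j, rfl, rfl⟩ := hx
  have hss : (s : ℝ) * s = 1 := by exact_mod_cast hs
  refine ⟨_, _, ⟨j - s * (i - a) * p, s * (i - a), rfl, rfl⟩, ?_, ?_⟩ <;> push_cast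
  · linear_combination (-(s : ℝ) * (i - a)) * hβ - (i - a) * hss
  · linear_combination (-(s : ℝ) * (i - a)) * hγ - (i - a) * hss

/-- The norm of a positive element of `ℤ[β]` is at least one in absolute value. -/
theorem one_le_mul_abs {p s : ℤ} (hsum : β + γ = p) (hprod : β * γ = -s)
    (hsq : ∀ k : ℤ, k ^ 2 ≠ p ^ 2 + 4 * s) (hx : IsConjPair β γ x x') (hpos : 0 < x) :
    1 ≤ x * |x'| := by
  obtain ⟨i, j, rfl, rfl⟩ := hx
  have hN : (i + j * β) * (i + j * γ) = ((i ^ 2 + p * i * j - s * j ^ 2 : ℤ) : ℝ) := by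
    push_cast
    linear_combination (i : ℝ) * j * hsum + (j : ℝ) ^ 2 * hprod
  rw [← abs_of_pos hpos, ← abs_mul, hN, ← Int.cast_abs]
  suffices h : i ^ 2 + p * i * j - s * j ^ 2 ≠ 0 by exact_mod_cast Int.one_le_abs h
  intro h0
  have h1 : (2 * i + p * j) ^ 2 = (p ^ 2 + 4 * s) * j ^ 2 := by linear_combination 4 * h0
  rcases eq_or_ne j 0 with rfl | hj
  · have : i = 0 := by simpa using h0
    simp [this] at hpos
  · have hd : j ∣ 2 * i + p * j :=
      (Int.pow_dvd_pow_iff two_ne_zero).1 ⟨p ^ 2 + 4 * s, by rw [h1]; ring⟩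
    obtain ⟨k, hk⟩ := hd
    apply hsq k
    rw [hk] at h1
    have : j ^ 2 ≠ 0 := pow_ne_zero 2 hj
    apply mul_right_cancel₀ this
    linear_combination h1

theorem exists_least (hβγ : γ < β) {a b : ℝ}
    (h : ∃ z z', IsConjPair β γ z z' ∧ 0 < z ∧ a < z' ∧ z' < b) :
    ∃ u u', IsConjPair β γ u u' ∧ 0 < u ∧ a < u' ∧ u' < b ∧
      ∀ z z', IsConjPair β γ z z' → 0 < z → a < z' → z' < b → u ≤ z := by
  obtain ⟨z₀, z₀', ⟨i₀, j₀, hz₀, hz₀'⟩, hpos, ha, hb⟩ := h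
  let T : Set (ℤ × ℤ) := {q | 0 < q.1 + q.2 * β ∧ q.1 + q.2 * β ≤ z₀ ∧
    a < q.1 + q.2 * γ ∧ q.1 + q.2 * γ < b}
  obtain ⟨J, hJ⟩ := exists_nat_ge ((z₀ + |a| + |b|) / (β - γ))
  rw [div_le_iff₀ (by linarith)] at hJ
  obtain ⟨I, hI⟩ := exists_nat_ge (z₀ + J * |β|)
  have hT : T.Finite := by
    apply ((Set.finite_Icc (-(I : ℤ)) I).prod (Set.finite_Icc (-(J : ℤ)) J)).subset
    rintro ⟨i, j⟩ ⟨h1, h2, h3, h4⟩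
    simp only at h1 h2 h3 h4
    have e1 := neg_abs_le a
    have e2 := le_abs_self b
    have hb0 := abs_nonneg b
    have ha0 := abs_nonneg a
    have hj : |(j : ℝ)| ≤ J := by
      have : |(j : ℝ)| * (β - γ) ≤ J * (β - γ) := by
        rw [← abs_of_pos (sub_pos.2 hβγ), ← abs_mul, abs_of_pos (sub_pos.2 hβγ)]
        refine le_trans (abs_le.2 ⟨?_, ?_⟩) hJ <;> linarith
      exact le_of_mul_le_mul_right this (by linarith)
    have hi : |(i : ℝ)| ≤ I := by
      have h5 : |(j : ℝ) * β| ≤ J * |β| := by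
        rw [abs_mul]; gcongr
      obtain ⟨h6, h7⟩ := abs_le.1 h5
      refine abs_le.2 ⟨?_, ?_⟩ <;> linarith
    obtain ⟨j1, j2⟩ := abs_le.1 hj
    obtain ⟨i1, i2⟩ := abs_le.1 hi
    exact ⟨⟨by exact_mod_cast i1, by exact_mod_cast i2⟩,
      ⟨by exact_mod_cast j1, by exact_mod_cast j2⟩⟩
  have hne : T.Nonempty :=
    ⟨(i₀, j₀), by rw [hz₀] at hpos; exact hpos, hz₀.ge, by rw [hz₀'] at ha; exact ha,
      by rw [hz₀'] at hb; exact hb⟩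
  obtain ⟨⟨i, j⟩, ⟨h1, h2, h3, h4⟩, hmin⟩ :=
    Set.exists_min_image T (fun q => (q.1 : ℝ) + q.2 * β) hT hne
  refine ⟨_, _, ⟨i, j, rfl, rfl⟩, h1, h3, h4, ?_⟩
  rintro z z' ⟨k, l, rfl, rfl⟩ g1 g2 g3
  rcases le_total ((k : ℝ) + l * β) z₀ with h | h
  · exact hmin (k, l) ⟨g1, h, g2, g3⟩
  · exact h2.trans h

end IsConjPair

section Spectrum

variable {β γ : ℝ} {m : ℕ}

theorem natCast_mem_Xspec {a : ℕ} (ha : a ≤ m) : (a : ℝ) ∈ Xspec β m :=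
  ⟨0, fun _ => a, fun _ _ => ha, by simp⟩

theorem add_mul_mem_Xspec {a : ℕ} (ha : a ≤ m) {x : ℝ} (hx : x ∈ Xspec β m) :
    a + β * x ∈ Xspec β m := by
  obtain ⟨n, c, hc, rfl⟩ := hx
  refine ⟨n + 1, fun j => if j = 0 then a else c (j - 1), ?_, ?_⟩
  · intro j hj
    rcases j with _ | j
    · simpa using ha
    · simpa using hc j (by omega)
  · rw [Finset.sum_range_succ' _ (n + 1), Finset.mul_sum]
    simp only [Nat.add_sub_cancel, Nat.succ_ne_zero, if_false, if_true, pow_zero, mul_one]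
    rw [add_comm]
    congr 1
    exact Finset.sum_congr rfl fun j _ => by ring

theorem pow_mem_Xspec (hm : 1 ≤ m) (n : ℕ) : β ^ n ∈ Xspec β m := by
  induction n with
  | zero => simpa using natCast_mem_Xspec (β := β) hm
  | succ n ih => simpa [pow_succ'] using add_mul_mem_Xspec (Nat.zero_le m) ih

theorem Xspec_induction {P : ℝ → Prop} (h0 : P 0)
    (hstep : ∀ a ≤ m, ∀ x, P x → P (a + β * x)) {x : ℝ} (hx : x ∈ Xspec β m) : P x := by
  obtain ⟨n, c, hc, rfl⟩ := hx
  have key : ∀ (n : ℕ) (c : ℕ → ℕ), (∀ j < n, c j ≤ m) →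
      P (∑ j ∈ Finset.range n, (c j : ℝ) * β ^ j) := by
    intro n
    induction n with
    | zero => intro c _; simpa using h0
    | succ n ih =>
      intro c hc
      have h := hstep (c 0) (hc 0 (by omega)) _ (ih (fun j => c (j + 1)) fun j hj =>
        hc (j + 1) (by omega))
      rw [Finset.sum_range_succ', add_comm]
      convert h using 2
      · simp
      · rw [Finset.mul_sum]
        exact Finset.sum_congr rfl fun j _ => by ring
  exact key (n + 1) c fun j hj => hc j (by omega)

theorem exists_digits_of_mem_Xspec {x : ℝ} (hx : x ∈ Xspec β m) :
    ∃ (n : ℕ) (c : ℕ → ℕ), (∀ j, c j ≤ m) ∧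
      ∀ N ≥ n, x = ∑ j ∈ Finset.range (N + 1), (c j : ℝ) * β ^ j := by
  obtain ⟨n, c, hc, rfl⟩ := hx
  refine ⟨n, fun j => if j ≤ n then c j else 0, fun j => ?_, fun N hN => ?_⟩
  · dsimp only
    split_ifs with h
    · exact hc j h
    · exact Nat.zero_le m
  · rw [← Finset.sum_subset (Finset.range_mono (Nat.succ_le_succ hN))]
    · refine Finset.sum_congr rfl fun j hj => ?_
      have h : j ≤ n := by simpa [Nat.lt_succ_iff] using hj
      simp [h]
    · intro j _ hj
      have h : ¬ j ≤ n := by simpa [Nat.lt_succ_iff] using hj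
      simp [h]

theorem add_mem_Xspec {k : ℕ} {x y : ℝ} (hx : x ∈ Xspec β m) (hy : y ∈ Xspec β k) :
    x + y ∈ Xspec β (m + k) := by
  obtain ⟨n, c, hc, hxs⟩ := exists_digits_of_mem_Xspec hx
  obtain ⟨l, d, hd, hys⟩ := exists_digits_of_mem_Xspec hy
  refine ⟨max n l, fun j => c j + d j, fun j _ => add_le_add (hc j) (hd j), ?_⟩
  rw [hxs _ (le_max_left n l), hys _ (le_max_right n l), ← Finset.sum_add_distrib]
  exact Finset.sum_congr rfl fun j _ => by push_cast; ring

theorem FillsWindow.succ {l r : ℝ} (hl : l ≤ 0) (hr : 0 < r) (hm : 1 ≤ m)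
    (hc : 0 < (m - 1) * r - m * l)
    (hleft : ∀ ε > 0, ∃ e e', IsConjPair β γ e e' ∧ e ∈ Xspec β 1 ∧ l ≤ e' ∧ e' ≤ l + ε)
    (hright : ∀ ε > 0, ∃ e e', IsConjPair β γ e e' ∧ e ∈ Xspec β 1 ∧ r - ε ≤ e' ∧ e' ≤ r)
    (h : FillsWindow β γ (m * l) (m * r) m) :
    FillsWindow β γ ((m + 1 : ℕ) * l) ((m + 1 : ℕ) * r) (m + 1) := by
  intro ε hε
  have hm' : (1 : ℝ) ≤ m := by exact_mod_cast hm
  obtain ⟨a, a', haL, haX, ha1, ha2⟩ := hleft (ε / 2) (by linarith)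
  obtain ⟨b, b', hbL, hbX, hb1, hb2⟩ := hright (ε / 2) (by linarith)
  obtain ⟨δ, hδ0, hδ1, hδ2, hδ3⟩ : ∃ δ > 0, δ ≤ ε / 2 ∧ 2 * δ ≤ (m - 1) * r - m * l ∧
      2 * δ ≤ r :=
    ⟨min (ε / 2) (min (((m - 1) * r - m * l) / 2) (r / 2)), by
      refine lt_min (by linarith) (lt_min (by linarith) (by linarith)), min_le_left _ _, by
      linarith [(min_le_right (ε / 2) (min (((m - 1) * r - m * l) / 2) (r / 2))).trans
        (min_le_left _ _)], by
      linarith [(min_le_right (ε / 2) (min (((m - 1) * r - m * l) / 2) (r / 2))).trans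
        (min_le_right _ _)]⟩
  obtain ⟨R, hR⟩ := h δ hδ0
  refine ⟨R + |a| + |b|, fun x x' hx hxR hx1 hx2 => ?_⟩
  push_cast at hx1 hx2
  have e1 := le_abs_self a
  have e2 := le_abs_self b
  have e3 := abs_nonneg a
  have e4 := abs_nonneg b
  have hml : ((m : ℝ) - 1) * l ≤ 0 := mul_nonpos_of_nonneg_of_nonpos (by linarith) hl
  have hmr : 0 ≤ ((m : ℝ) - 1) * r := mul_nonneg (by linarith) hr.le
  rcases lt_or_ge x' (m * l + δ) with h1 | h1
  · have := add_mem_Xspec (hR _ _ (hx.sub haL) (by linarith) (by linarith) (by linarith)) haX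
    simpa using this
  rcases le_or_gt x' (m * r - δ) with h2 | h2
  · have := add_mem_Xspec (hR _ _ hx (by linarith) h1 h2)
      (natCast_mem_Xspec (β := β) (Nat.zero_le 1))
    simpa using this
  · have := add_mem_Xspec (hR _ _ (hx.sub hbL) (by linarith) (by linarith) (by linarith)) hbX
    simpa using this

/-- A spectrum filling the window `[l, r)` of the conjugate has eventually only three gaps. -/
theorem exists_three_gaps {l r : ℝ} (hβ : 1 < β) (hβγ : γ < β) (hm : 1 ≤ m)
    (hnorm : ∀ z z', IsConjPair β γ z z' → 0 < z → 1 ≤ z * |z'|)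
    (hmem : ∀ x ∈ Xspec β m, ∃ x', IsConjPair β γ x x' ∧ l ≤ x' ∧ x' < r)
    (hfill : FillsWindow β γ l r m)
    (hu : ∃ z z', IsConjPair β γ z z' ∧ 0 < z ∧ 0 < z' ∧ z' < r - l)
    (hv : ∃ z z', IsConjPair β γ z z' ∧ 0 < z ∧ -(r - l) < z' ∧ z' < 0) :
    ∃ Δ₁ Δ₂ : ℝ, 0 < Δ₁ ∧ 0 < Δ₂ ∧
      ∀ y : ℕ → ℝ, StrictMono y → y 0 = 0 → Set.range y = Xspec β m →
        ∃ N : ℕ, ∀ k ≥ N, y (k + 1) - y k ∈ ({Δ₁, Δ₂, Δ₁ + Δ₂} : Set ℝ) := by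
  obtain ⟨u, u', huL, hu0, hu1, hu2, humin⟩ := IsConjPair.exists_least hβγ hu
  obtain ⟨v, v', hvL, hv0, hv1, hv2, hvmin⟩ := IsConjPair.exists_least hβγ hv
  refine ⟨u, v, hu0, hv0, fun y hy _ hrange => ?_⟩
  have huv : 0 < u + v := by linarith
  obtain ⟨ε, hε0, hε1, hε2, hε3, hε4, hε5⟩ : ∃ ε > 0, ε ≤ u' ∧ ε ≤ -v' ∧
      2 * ε ≤ r - l - u' ∧ 2 * ε ≤ r - l + v' ∧ ε ≤ 1 / (u + v) := by
    have h : ∀ᶠ ε in nhdsWithin (0 : ℝ) (Set.Ioi 0), 0 < ε ∧ ε < min (min u' (-v'))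
        (min (min ((r - l - u') / 2) ((r - l + v') / 2)) (1 / (u + v))) := by
      apply Ioo_mem_nhdsGT
      refine lt_min (lt_min hu1 (by linarith)) (lt_min (lt_min ?_ ?_) (by positivity)) <;> linarith
    obtain ⟨ε, h0, h⟩ := h.exists
    simp only [lt_min_iff] at h
    exact ⟨ε, h0, by linarith, by linarith, by linarith, by linarith, by linarith⟩
  obtain ⟨R, hR⟩ := hfill ε hε0
  obtain ⟨n, hn⟩ := pow_unbounded_of_one_lt R hβ
  obtain ⟨N, hN⟩ : β ^ n ∈ Set.range y := hrange ▸ pow_mem_Xspec hm n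
  refine ⟨N, fun k hk => ?_⟩
  have hkR : R ≤ y k := by
    have := hy.monotone hk
    linarith
  have hnext : ∀ w ∈ Xspec β m, y k < w → y (k + 1) ≤ w := by
    intro w hw hlt
    rw [← hrange] at hw
    obtain ⟨i, rfl⟩ := hw
    exact hy.monotone (Nat.succ_le_of_lt (hy.lt_iff_lt.1 hlt))
  obtain ⟨x', hxL, hx1, hx2⟩ := hmem (y k) (hrange ▸ Set.mem_range_self k)
  obtain ⟨w', hwL, hw1, hw2⟩ := hmem (y (k + 1)) (hrange ▸ Set.mem_range_self (k + 1))
  have hzL := hwL.sub hxL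
  have hz0 : 0 < y (k + 1) - y k := sub_pos.2 (hy (Nat.lt_succ_self k))
  have hnext' : ∀ d d', IsConjPair β γ d d' → 0 < d → l + ε ≤ x' + d' → x' + d' ≤ r - ε →
      y (k + 1) - y k ≤ d := by
    intro d d' hd hd0 h1 h2
    have := hnext _ (hR _ _ (hxL.add hd) (by linarith) h1 h2) (by linarith)
    linarith
  set z := y (k + 1) - y k with hz
  have hle : z ≤ u + v := by
    rcases le_or_gt (x' + u') (r - ε) with h1 | h1
    · have := hnext' u u' huL hu0 (by linarith) h1
      linarith
    rcases le_or_gt (l + ε) (x' + v') with h2 | h2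
    · have := hnext' v v' hvL hv0 h2 (by linarith)
      linarith
    · exact hnext' _ _ (huL.add hvL) huv (by linarith) (by linarith)
  have hmargin : ∀ d d', IsConjPair β γ d d' → 0 < d → d ≤ u + v → ε ≤ |d'| := by
    intro d d' hd hd0 hd1
    have h1 := hnorm d d' hd hd0
    have h2 : 1 ≤ (u + v) * |d'| := h1.trans (by gcongr)
    refine hε5.trans ?_
    rw [div_le_iff₀ huv]
    linarith
  simp only [Set.mem_insert_iff, Set.mem_singleton_iff]
  rcases lt_trichotomy (w' - x') 0 with hs | hs | hs
  · have hvz := hvmin _ _ hzL hz0 (by linarith) hs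
    rcases hvz.eq_or_lt with h | h
    · exact Or.inr (Or.inl h.symm)
    have hdL := hzL.sub hvL
    have hd0 : 0 < z - v := by linarith
    have hm' := hmargin _ _ hdL hd0 (by linarith)
    rcases le_or_gt 0 (w' - x' - v') with h3 | h3
    · have hpos : 0 < w' - x' - v' := by rw [abs_of_nonneg h3] at hm'; linarith
      have := humin _ _ hdL hd0 hpos (by linarith)
      exact Or.inr (Or.inr (by linarith))
    · rw [abs_of_neg h3] at hm'
      have := hnext' v v' hvL hv0 (by linarith) (by linarith)
      linarith
  · have := hmargin _ _ hzL hz0 hle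
    rw [hs, abs_zero] at this
    linarith
  · have huz := humin _ _ hzL hz0 hs (by linarith)
    rcases huz.eq_or_lt with h | h
    · exact Or.inl h.symm
    have hdL := hzL.sub huL
    have hd0 : 0 < z - u := by linarith
    have hm' := hmargin _ _ hdL hd0 (by linarith)
    rcases le_or_gt 0 (w' - x' - u') with h3 | h3
    · rw [abs_of_nonneg h3] at hm'
      have := hnext' u u' huL hu0 (by linarith) (by linarith)
      linarith
    · have := hvmin _ _ hdL hd0 (by linarith) h3
      exact Or.inr (Or.inr (by linarith))

end Spectrum

section NormNegOne

variable {β γ : ℝ} {p m : ℕ}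

theorem mem_Xspec_of_norm_neg_one (hp : 1 ≤ p) (hβ : 1 < β) (hsum : β + γ = p)
    (hprod : β * γ = -1) (n : ℕ) : ∀ x x', IsConjPair β γ x x' → 0 ≤ x → x < β ^ n → -1 < x' →
      x' < β → x ∈ Xspec β p := by
  have hp' : (1 : ℝ) ≤ p := by exact_mod_cast hp
  have hγ0 : γ < 0 := by nlinarith
  have hγ1 : -1 < γ := by nlinarith
  have small : ∀ x x', IsConjPair β γ x x' → 0 ≤ x → x < p → -1 < x' → x' < β →
      x ∈ Xspec β p := by
    rintro _ _ ⟨i, j, rfl, rfl⟩ h1 h2 h3 h4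
    rcases lt_trichotomy j 0 with hj | rfl | hj
    · have : (j : ℝ) ≤ -1 := by exact_mod_cast Int.le_sub_one_of_lt hj
      nlinarith
    · simp only [Int.cast_zero, zero_mul, add_zero] at *
      lift i to ℕ using by exact_mod_cast h1
      exact natCast_mem_Xspec (by exact_mod_cast h2.le)
    · rcases (show j = 1 ∨ 2 ≤ j by omega) with rfl | hj
      · simp only [Int.cast_one, one_mul] at *
        have hi : i < 0 := by
          have : (i : ℝ) < 0 := by linarith
          exact_mod_cast this
        have : (i : ℝ) ≤ -1 := by exact_mod_cast Int.le_sub_one_of_lt hi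
        linarith
      · have : (2 : ℝ) ≤ j := by exact_mod_cast hj
        nlinarith
  have hβ2 : β ^ 2 = ((p : ℤ) : ℝ) * β + ((1 : ℤ) : ℝ) := by
    push_cast; linear_combination β * hsum - hprod
  have hγ2 : γ ^ 2 = ((p : ℤ) : ℝ) * γ + ((1 : ℤ) : ℝ) := by
    push_cast; linear_combination γ * hsum - hprod
  induction n with
  | zero =>
    intro x x' hx h1 h2 h3 h4
    exact small x x' hx h1 (by simp at h2; linarith) h3 h4
  | succ n ih =>
    intro x x' hx h1 h2 h3 h4
    rcases lt_or_ge x p with h5 | h5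
    · exact small x x' hx h1 h5 h3 h4
    obtain ⟨a, ha, ha1, ha2⟩ : ∃ a : ℕ, a ≤ p ∧ -1 < x' - a ∧ x' - a < -γ := by
      rcases le_or_gt x' p with h6 | h6
      · have hc0 : 0 ≤ ⌈x'⌉ := by
          rw [← Int.sub_one_lt_iff, Int.lt_ceil]; simpa using h3
        obtain ⟨a, ha⟩ := Int.eq_ofNat_of_zero_le hc0
        have e1 := Int.le_ceil x'
        have e2 := Int.ceil_lt_add_one x'
        have e3 : ⌈x'⌉ ≤ p := Int.ceil_le.2 (by exact_mod_cast h6)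
        rw [ha] at e1 e2 e3
        push_cast at e1 e2
        exact ⟨a, by exact_mod_cast e3, by linarith, by linarith⟩
      · exact ⟨p, le_rfl, by linarith, by linarith⟩
    obtain ⟨y, y', hy, rfl, rfl⟩ := hx.exists_eq_add_mul (by norm_num) hβ2 hγ2 a
    simp only [Int.cast_natCast] at *
    have ha' : (a : ℝ) ≤ p := by exact_mod_cast ha
    have ha0 : (0 : ℝ) ≤ a := a.cast_nonneg
    have hy0 : 0 ≤ y := by nlinarith
    refine add_mul_mem_Xspec ha (ih y y' hy hy0 ?_ ?_ ?_)
    · rw [pow_succ'] at h2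
      exact lt_of_mul_lt_mul_left (by linarith) (by linarith : 0 ≤ β)
    · nlinarith
    · nlinarith

theorem fillsWindow_of_norm_neg_one (hp : 1 ≤ p) (hβ : 1 < β) (hsum : β + γ = p)
    (hprod : β * γ = -1) (hpm : p ≤ m) :
    FillsWindow β γ (m * (-1 / p)) (m * (β / p)) m := by
  have hp' : (1 : ℝ) ≤ p := by exact_mod_cast hp
  have hp0 : (0 : ℝ) < p := by linarith
  have hγ0 : γ < 0 := by nlinarith
  have hγ1 : -1 < γ := by nlinarith
  have hβ2 : β ^ 2 = ((p : ℤ) : ℝ) * β + ((1 : ℤ) : ℝ) := by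
    push_cast; linear_combination β * hsum - hprod
  have hγ2 : γ ^ 2 = ((p : ℤ) : ℝ) * γ + ((1 : ℤ) : ℝ) := by
    push_cast; linear_combination γ * hsum - hprod
  have hseq : ∀ k : ℕ, ∃ e, IsConjPair β γ e (β / p * (1 - (γ ^ 2) ^ k)) ∧ e ∈ Xspec β 1 := by
    intro k
    induction k with
    | zero => exact ⟨0, by simpa using IsConjPair.natCast 0,
        by simpa using natCast_mem_Xspec (β := β) (Nat.zero_le 1)⟩
    | succ k ih =>
      obtain ⟨e, he, heX⟩ := ih
      refine ⟨(1 : ℕ) + β * ((0 : ℕ) + β * e), ?_,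
        add_mul_mem_Xspec le_rfl (add_mul_mem_Xspec (Nat.zero_le 1) heX)⟩
      convert (IsConjPair.natCast 1).add (((IsConjPair.natCast 0).add
        (he.mul_base hβ2 hγ2)).mul_base hβ2 hγ2) using 1
      rw [pow_succ]
      field_simp
      push_cast
      linear_combination hsum - γ * hprod
  have hsmall : ∀ ε > 0, ∃ k : ℕ, β / p * (γ ^ 2) ^ k < ε := by
    intro ε hε
    obtain ⟨k, hk⟩ := exists_pow_lt_of_lt_one (y := γ ^ 2) (show 0 < ε / (β / p) by positivity)
      (by nlinarith)
    rw [lt_div_iff₀ (by positivity)] at hk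
    exact ⟨k, by linarith⟩
  induction m, hpm using Nat.le_induction with
  | base =>
    rw [mul_div_cancel₀ _ hp0.ne', mul_div_cancel₀ _ hp0.ne']
    intro ε hε
    refine ⟨0, fun x x' hx h0 h1 h2 => ?_⟩
    obtain ⟨n, hn⟩ := pow_unbounded_of_one_lt x hβ
    exact mem_Xspec_of_norm_neg_one hp hβ hsum hprod n x x' hx h0 hn (by linarith) (by linarith)
  | succ m hpm ih =>
    have hm1 : 1 ≤ m := hp.trans hpm
    have hm' : (1 : ℝ) ≤ m := by exact_mod_cast hm1
    refine ih.succ (div_nonpos_of_nonpos_of_nonneg (by norm_num) hp0.le) (by positivity) hm1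
      ?_ ?_ ?_
    · have h1 : 0 ≤ ((m : ℝ) - 1) * (β / p) := mul_nonneg (by linarith) (by positivity)
      have h2 : 0 < (m : ℝ) * (1 / p) := by positivity
      rw [neg_div]
      linarith
    · intro ε hε
      obtain ⟨k, hk⟩ := hsmall ε hε
      obtain ⟨e, he, heX⟩ := hseq k
      refine ⟨_, _, he.mul_base hβ2 hγ2,
        by simpa using add_mul_mem_Xspec (Nat.zero_le 1) heX, ?_, ?_⟩
      all_goals
        have h1 : γ * (β / p * (1 - (γ ^ 2) ^ k)) = -1 / p - γ * (β / p * (γ ^ 2) ^ k) := by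
          field_simp
          linear_combination hprod
        have h2 : 0 ≤ β / p * (γ ^ 2) ^ k := by positivity
        rw [h1]
        nlinarith
    · intro ε hε
      obtain ⟨k, hk⟩ := hsmall ε hε
      obtain ⟨e, he, heX⟩ := hseq k
      have h2 : 0 ≤ β / p * (γ ^ 2) ^ k := by positivity
      exact ⟨_, _, he, heX, by linarith, by linarith⟩

theorem exists_conj_of_norm_neg_one (hp : 1 ≤ p) (hβ : 1 < β) (hsum : β + γ = p)
    (hprod : β * γ = -1) (hm : 1 ≤ m) {x : ℝ} (hx : x ∈ Xspec β m) :
    ∃ x', IsConjPair β γ x x' ∧ m * (-1 / p) < x' ∧ x' < m * (β / p) := by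
  have hp0 : (0 : ℝ) < p := by exact_mod_cast hp
  have hm0 : (0 : ℝ) < m := by exact_mod_cast hm
  have hγ0 : γ < 0 := by nlinarith
  have hβ2 : β ^ 2 = ((p : ℤ) : ℝ) * β + ((1 : ℤ) : ℝ) := by
    push_cast; linear_combination β * hsum - hprod
  have hγ2 : γ ^ 2 = ((p : ℤ) : ℝ) * γ + ((1 : ℤ) : ℝ) := by
    push_cast; linear_combination γ * hsum - hprod
  have e1 : γ * (m * (β / p)) = m * (-1 / p) := by
    field_simp
    linear_combination hprod
  have e2 : m + γ * (m * (-1 / p)) = m * (β / p) := by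
    field_simp
    linear_combination -hsum
  refine Xspec_induction (P := fun x => ∃ x', IsConjPair β γ x x' ∧ m * (-1 / p) < x' ∧
    x' < m * (β / p)) ?_ ?_ hx
  · refine ⟨0, by simpa using IsConjPair.natCast 0, ?_, by positivity⟩
    rw [neg_div, mul_neg]
    exact neg_neg_of_pos (by positivity)
  · rintro a ha x ⟨x', hL, h1, h2⟩
    have ha' : (a : ℝ) ≤ m := by exact_mod_cast ha
    have ha0 : (0 : ℝ) ≤ a := a.cast_nonneg
    refine ⟨_, (IsConjPair.natCast a).add (hL.mul_base hβ2 hγ2), ?_, ?_⟩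
    · have := mul_lt_mul_of_neg_left h2 hγ0
      linarith
    · have := mul_lt_mul_of_neg_left h1 hγ0
      linarith

end NormNegOne

section NormOne

variable {β γ : ℝ} {q m : ℕ}

theorem mem_Xspec_of_norm_one {d : ℝ} (hq : 2 ≤ q) (hβ : 1 < β) (hsum : β + γ = q + 1)
    (hprod : β * γ = 1) (hd : d * (β - 1) = 1) (n : ℕ) :
    ∀ x x', IsConjPair β γ x x' → 0 ≤ x → x < β ^ n → 0 ≤ x' → x' < β + d →
      β * d ^ 2 < (β + d - x') * (x + (1 + d - γ)) → x ∈ Xspec β q := by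
  have hq' : (2 : ℝ) ≤ q := by exact_mod_cast hq
  have hγ0 : 0 < γ := by nlinarith
  have hγ1 : γ < 1 := by nlinarith
  have hβ2 : 2 < β := by linarith
  have hγ2 : γ < 1 / 2 := by nlinarith
  have hd0 : 0 < d := by nlinarith
  have hd1 : d < 1 := by nlinarith
  have small : ∀ x x', IsConjPair β γ x x' → 0 ≤ x → x ≤ q + 1 → 0 ≤ x' → x' < β + d →
      β * d ^ 2 < (β + d - x') * (x + (1 + d - γ)) → x ∈ Xspec β q := by
    rintro _ _ ⟨i, j, rfl, rfl⟩ h1 h2 h3 h4 h5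
    rcases (show j ≤ -2 ∨ j = -1 ∨ j = 0 ∨ j = 1 ∨ 2 ≤ j by omega) with
      hj | rfl | rfl | rfl | hj
    · have : (j : ℝ) ≤ -2 := by exact_mod_cast hj
      nlinarith
    · push_cast at *
      have e1 : (q : ℤ) < i := by
        have : (q : ℝ) < i := by linarith
        exact_mod_cast this
      have e2 : i < q + 2 := by
        have : (i : ℝ) < q + 2 := by linarith
        exact_mod_cast this
      obtain rfl : i = q + 1 := by omega
      push_cast at *
      have : (β + d - (q + 1 + -1 * γ)) * (q + 1 + -1 * β + (1 + d - γ)) = β * d ^ 2 := by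
        have e3 : (q : ℝ) + 1 = β + γ := hsum.symm
        rw [e3]
        linear_combination -d * hd
      linarith
    · simp only [Int.cast_zero, zero_mul, add_zero] at *
      lift i to ℕ using by exact_mod_cast h1
      simp only [Int.cast_natCast] at *
      have e1 : i ≤ q + 1 := by exact_mod_cast h2
      rcases e1.eq_or_lt with rfl | e1
      · push_cast at *
        have : (β + d - (q + 1)) * (q + 1 + (1 + d - γ)) = β * d ^ 2 := by
          have e3 : (q : ℝ) + 1 = β + γ := hsum.symm
          rw [e3]
          have e4 : d * β = 1 + d := by linear_combination hd
          have e5 : d * γ = d - γ := by linear_combination d * hprod - γ * e4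
          linear_combination (-d + 1) * e4 - e5 - hprod
        linarith
      · exact natCast_mem_Xspec (by omega)
    · simp only [Int.cast_one, one_mul] at *
      have e1 : -1 < i := by
        have : (-1 : ℝ) < i := by linarith
        exact_mod_cast this
      have e2 : i < 1 := by
        have : (i : ℝ) < 1 := by linarith
        exact_mod_cast this
      obtain rfl : i = 0 := by omega
      simpa using pow_mem_Xspec (β := β) (m := q) (by omega) 1
    · have : (2 : ℝ) ≤ j := by exact_mod_cast hj
      nlinarith
  have hβ3 : β ^ 2 = ((q + 1 : ℤ) : ℝ) * β + ((-1 : ℤ) : ℝ) := by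
    push_cast; linear_combination β * hsum - hprod
  have hγ3 : γ ^ 2 = ((q + 1 : ℤ) : ℝ) * γ + ((-1 : ℤ) : ℝ) := by
    push_cast; linear_combination γ * hsum - hprod
  have e4 : d * β = 1 + d := by linear_combination hd
  have e5 : d * γ = d - γ := by linear_combination d * hprod - γ * e4
  induction n with
  | zero =>
    intro x x' hx h1 h2 h3 h4 h5
    exact small x x' hx h1 (by simp at h2; linarith) h3 h4 h5
  | succ n ih =>
    intro x x' hx h1 h2 h3 h4 h5
    rcases le_or_gt x (q + 1) with h6 | h6
    · exact small x x' hx h1 h6 h3 h4 h5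
    rw [pow_succ'] at h2
    rcases lt_or_ge x' q with h7 | h7
    · obtain ⟨y, y', hy, rfl, hy'⟩ :=
        hx.exists_eq_add_mul (by norm_num) hβ3 hγ3 (⌊x'⌋₊ : ℤ)
      simp only [Int.cast_natCast] at *
      have f1 := Nat.floor_le h3
      have f2 := Nat.lt_floor_add_one x'
      have f3 : ⌊x'⌋₊ < q := (Nat.floor_lt h3).2 h7
      have f4 : (⌊x'⌋₊ : ℝ) + 1 ≤ q := by exact_mod_cast f3
      have f0 : (0 : ℝ) ≤ ⌊x'⌋₊ := Nat.cast_nonneg _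
      have g0 : γ < y := by nlinarith
      have g1 : y < β ^ n := lt_of_mul_lt_mul_left (by linarith) (by linarith : 0 ≤ β)
      have g2 : 0 ≤ y' := by nlinarith
      have g3 : y' < β := by nlinarith
      refine add_mul_mem_Xspec f3.le (ih y y' hy (by linarith) g1 g2 (by linarith) ?_)
      calc β * d ^ 2 = d * (1 + d) := by linear_combination d * e4
        _ < (β + d - y') * (y + (1 + d - γ)) :=
          mul_lt_mul'' (by linarith) (by linarith) hd0.le (by linarith)
    · obtain ⟨y, y', hy, rfl, rfl⟩ :=
        hx.exists_eq_add_mul (by norm_num) hβ3 hγ3 (q : ℤ)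
      simp only [Int.cast_natCast] at *
      have g0 : 0 ≤ y := by nlinarith
      have g1 : y < β ^ n := lt_of_mul_lt_mul_left (by linarith) (by linarith : 0 ≤ β)
      have g2 : 0 ≤ y' := by nlinarith
      have g3 : β + d - (q + γ * y') = γ * (β + d - y') := by
        linear_combination hsum - hprod - e5
      have g4 : q + β * y + (1 + d - γ) = β * (y + (1 + d - γ)) := by
        linear_combination -hsum - e4 + hprod
      have g5 : y' < β + d := by
        have : 0 < γ * (β + d - y') := by linarith
        linarith [pos_of_mul_pos_right this hγ0.le]
      refine add_mul_mem_Xspec le_rfl (ih y y' hy g0 g1 g2 g5 ?_)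
      rw [g3, g4] at h5
      calc _ < _ := h5
        _ = _ := by linear_combination (β + d - y') * (y + (1 + d - γ)) * hprod

theorem fillsWindow_of_norm_one (hq : 2 ≤ q) (hβ : 1 < β) (hsum : β + γ = q + 1)
    (hprod : β * γ = 1) (hqm : q ≤ m) :
    FillsWindow β γ (m * 0) (m * (β / (β - 1))) m := by
  have hq' : (2 : ℝ) ≤ q := by exact_mod_cast hq
  have hb : 0 < β - 1 := by linarith
  have hγ0 : 0 < γ := by nlinarith
  have hγ1 : γ < 1 := by nlinarith
  have hβ3 : β ^ 2 = ((q + 1 : ℤ) : ℝ) * β + ((-1 : ℤ) : ℝ) := by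
    push_cast; linear_combination β * hsum - hprod
  have hγ3 : γ ^ 2 = ((q + 1 : ℤ) : ℝ) * γ + ((-1 : ℤ) : ℝ) := by
    push_cast; linear_combination γ * hsum - hprod
  have hseq : ∀ k : ℕ, ∃ e, IsConjPair β γ e (β / (β - 1) * (1 - γ ^ k)) ∧ e ∈ Xspec β 1 := by
    intro k
    induction k with
    | zero => exact ⟨0, by simpa using IsConjPair.natCast 0,
        by simpa using natCast_mem_Xspec (β := β) (Nat.zero_le 1)⟩
    | succ k ih =>
      obtain ⟨e, he, heX⟩ := ih
      refine ⟨(1 : ℕ) + β * e, ?_, add_mul_mem_Xspec le_rfl heX⟩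
      convert (IsConjPair.natCast 1).add (he.mul_base hβ3 hγ3) using 1
      rw [pow_succ]
      field_simp
      push_cast
      linear_combination -hprod
  induction m, hqm using Nat.le_induction with
  | base =>
    intro ε hε
    obtain ⟨d, hd⟩ : ∃ d, d * (β - 1) = 1 := ⟨1 / (β - 1), by field_simp⟩
    have hr : q * (β / (β - 1)) = β + d := by
      field_simp
      linear_combination -β * hsum + hprod - hd
    have hd0 : 0 < d := by nlinarith
    refine ⟨β * d ^ 2 / ε, fun x x' hx h0 h1 h2 => ?_⟩
    obtain ⟨n, hn⟩ := pow_unbounded_of_one_lt x hβ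
    rw [hr] at h2
    have hx0 : 0 ≤ x := le_trans (by positivity) h0
    rw [div_le_iff₀ hε] at h0
    refine mem_Xspec_of_norm_one hq hβ hsum hprod hd n x x' hx hx0 hn (by linarith)
      (by linarith) ?_
    calc β * d ^ 2 ≤ ε * x := by linarith
      _ < ε * (x + (1 + d - γ)) := by gcongr; linarith
      _ ≤ _ := by
        gcongr
        · linarith
        · linarith
  | succ m hqm ih =>
    have hm1 : 1 ≤ m := by omega
    have hm' : (2 : ℝ) ≤ m := by exact_mod_cast hq.trans hqm
    have hr0 : 0 < β / (β - 1) := by positivity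
    refine ih.succ le_rfl hr0 hm1 ?_ ?_ ?_
    · rw [mul_zero, sub_zero]
      exact mul_pos (by linarith) hr0
    · intro ε hε
      exact ⟨0, 0, by simpa using IsConjPair.natCast 0,
        by simpa using natCast_mem_Xspec (β := β) (Nat.zero_le 1), le_rfl, by linarith⟩
    · intro ε hε
      obtain ⟨k, hk⟩ := exists_pow_lt_of_lt_one (show 0 < ε / (β / (β - 1)) by positivity) hγ1
      rw [lt_div_iff₀ hr0] at hk
      obtain ⟨e, he, heX⟩ := hseq k
      have h2 : 0 ≤ γ ^ k * (β / (β - 1)) := by positivity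
      exact ⟨_, _, he, heX, by linarith, by linarith⟩

theorem exists_conj_of_norm_one (hβ : 1 < β) (hsum : β + γ = q + 1)
    (hprod : β * γ = 1) (hm : 1 ≤ m) {x : ℝ} (hx : x ∈ Xspec β m) :
    ∃ x', IsConjPair β γ x x' ∧ m * 0 ≤ x' ∧ x' < m * (β / (β - 1)) := by
  have hb : 0 < β - 1 := by linarith
  have hm0 : (0 : ℝ) < m := by exact_mod_cast hm
  have hγ0 : 0 < γ := by nlinarith
  have hβ3 : β ^ 2 = ((q + 1 : ℤ) : ℝ) * β + ((-1 : ℤ) : ℝ) := by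
    push_cast; linear_combination β * hsum - hprod
  have hγ3 : γ ^ 2 = ((q + 1 : ℤ) : ℝ) * γ + ((-1 : ℤ) : ℝ) := by
    push_cast; linear_combination γ * hsum - hprod
  have e2 : m + γ * (m * (β / (β - 1))) = m * (β / (β - 1)) := by
    field_simp
    linear_combination hprod
  simp only [mul_zero]
  refine Xspec_induction (P := fun x => ∃ x', IsConjPair β γ x x' ∧ 0 ≤ x' ∧
    x' < m * (β / (β - 1))) ?_ ?_ hx
  · exact ⟨0, by simpa using IsConjPair.natCast 0, le_rfl, by positivity⟩
  · rintro a ha x ⟨x', hL, h1, h2⟩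
    have ha' : (a : ℝ) ≤ m := by exact_mod_cast ha
    refine ⟨_, (IsConjPair.natCast a).add (hL.mul_base hβ3 hγ3), by positivity, ?_⟩
    have := mul_lt_mul_of_pos_left h2 hγ0
    linarith

end NormOne

/-- Theorem 1: for a quadratic Pisot unit `β` and `m > β - 1`, the distances between
consecutive points of `X^m(β)` take, up to finitely many exceptions, values in
`{Δ₁, Δ₂, Δ₁ + Δ₂}`. -/
theorem spectrum_gaps_three_values (β : ℝ) (p : ℤ)
    (hβ : 1 < β)
    (hp : (1 ≤ p ∧ β ^ 2 = p * β + 1) ∨ (3 ≤ p ∧ β ^ 2 = p * β - 1))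
    (m : ℕ) (hm : (m : ℝ) > β - 1) :
    ∃ Δ₁ Δ₂ : ℝ, 0 < Δ₁ ∧ 0 < Δ₂ ∧
      ∀ y : ℕ → ℝ, StrictMono y → y 0 = 0 → Set.range y = Xspec β m →
        ∃ N : ℕ, ∀ k ≥ N, y (k + 1) - y k ∈ ({Δ₁, Δ₂, Δ₁ + Δ₂} : Set ℝ) := by
  obtain ⟨γ, hsum⟩ : ∃ γ, β + γ = p := ⟨p - β, by ring⟩
  rcases hp with ⟨hp, heq⟩ | ⟨hp, heq⟩
  · lift p to ℕ using by omega
    simp only [Int.cast_natCast] at *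
    have hp1 : 1 ≤ p := by exact_mod_cast hp
    have hprod : β * γ = -1 := by linear_combination β * hsum - heq
    have hp0 : (1 : ℝ) ≤ p := by exact_mod_cast hp1
    have hγ0 : γ < 0 := by nlinarith
    have hγ1 : -1 < γ := by nlinarith
    have hpm : p ≤ m := by
      have : (p : ℝ) < m + 1 := by linarith
      exact Nat.lt_succ_iff.1 (by exact_mod_cast this)
    have hpm' : (p : ℝ) ≤ m := by exact_mod_cast hpm
    have hW : 1 < m * (β / p) - m * (-1 / p) := by
      have : m * (β / p) - m * (-1 / p) = (m / p) * (β + 1) := by ring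
      rw [this]
      have : 1 ≤ (m : ℝ) / p := by rwa [one_le_div (by linarith)]
      nlinarith
    refine exists_three_gaps hβ (by linarith) (hp1.trans hpm) ?_
      (fun x hx => ?_) (fillsWindow_of_norm_neg_one hp1 hβ hsum hprod hpm)
      ⟨1, 1, by simpa using IsConjPair.natCast 1, one_pos, one_pos, hW⟩
      ⟨β, γ, IsConjPair.base, by linarith, by linarith, hγ0⟩
    · intro z z' hz hz0
      refine hz.one_le_mul_abs (p := p) (s := 1) (by exact_mod_cast hsum)
        (by push_cast; exact hprod) ?_ hz0
      intro k hk
      have h1 : (p : ℤ) < |k| := by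
        rw [← sq_abs] at hk
        nlinarith [abs_nonneg k]
      rw [← sq_abs] at hk
      rcases (show |k| = p + 1 ∨ (p : ℤ) + 2 ≤ |k| by omega) with h | h
      · rw [h] at hk
        ring_nf at hk
        omega
      · nlinarith
    · obtain ⟨x', h1, h2, h3⟩ :=
        exists_conj_of_norm_neg_one hp1 hβ hsum hprod (hp1.trans hpm) hx
      exact ⟨x', h1, h2.le, h3⟩
  · obtain ⟨q, rfl⟩ : ∃ q : ℕ, p = q + 1 := ⟨(p - 1).toNat, by omega⟩
    push_cast at *
    have hq : 2 ≤ q := by omega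
    have hprod : β * γ = 1 := by linear_combination β * hsum - heq
    have hq0 : (2 : ℝ) ≤ q := by exact_mod_cast hq
    have hγ0 : 0 < γ := by nlinarith
    have hγ1 : γ < 1 := by nlinarith
    have hqm : q ≤ m := by
      have : (q : ℝ) < m + 1 := by linarith
      exact Nat.lt_succ_iff.1 (by exact_mod_cast this)
    have hm1 : 1 ≤ m := by omega
    have hb : 0 < β - 1 := by linarith
    have hW : 1 < m * (β / (β - 1)) - m * 0 := by
      have h1 : m * (β / (β - 1)) - m * 0 = (m / (β - 1)) * β := by ring
      rw [h1]
      have : 1 < (m : ℝ) / (β - 1) := by rwa [one_lt_div hb]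
      nlinarith
    refine exists_three_gaps hβ (by linarith) hm1 ?_
      (fun x hx => exists_conj_of_norm_one hβ hsum hprod hm1 hx)
      (fillsWindow_of_norm_one hq hβ hsum hprod hqm)
      ⟨1, 1, by simpa using IsConjPair.natCast 1, one_pos, one_pos, hW⟩
      ⟨β - 1, γ - 1, by simpa using IsConjPair.base.sub (IsConjPair.natCast 1), hb,
        by linarith, by linarith⟩
    intro z z' hz hz0
    refine hz.one_le_mul_abs (p := q + 1) (s := -1) (by exact_mod_cast hsum)
      (by push_cast; linarith) ?_ hz0
    intro k hk
    rw [← sq_abs] at hk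
    have h0 := abs_nonneg k
    have h1 : |k| < q + 1 := by nlinarith
    have h2 : |k| ≤ q := by omega
    nlinarith
end

section
/- Let γ ∈ ℝ with |γ| > 1, let 𝒜 = {a,…,A} ⊂ ℤ with a ≤ 0 ≤ A and A − a > |γ| − 1, and let b, B ∈ ℤ satisfy a ≤ b ≤ 0 ≤ B ≤ A and B − b = ⌊|γ|⌋. Write 𝓘_{γ,𝒜} = [ℓ, r] where ℓ = aγ/(γ−1), r = Aγ/(γ−1) if γ > 1 and ℓ = (A+aγ)γ/(γ²−1), r = (a+Aγ)γ/(γ²−1) if γ < −1. Set L = b/(γ−1) if γ > 1 and L = (b−γ)/(γ−1) if γ < −1; define the partition 𝓘_a = [ℓ, L+a+1), 𝓘_k = [L+k, L+k+1) for a < k < A, 𝓘_A = [L+A, r], the digit map D(w) = k for w ∈ 𝓘_k, the transformation T(w) = γ(w − D(w)), and the interval I = γ·[L, L+1) (the image of [L, L+1) under multiplication by γ). Then: (i) T maps 𝓘_{γ,𝒜} into 𝓘_{γ,𝒜}; (ii) T(𝓘_k) ⊆ I for every k with a < k < A; (iii) I ⊆ ⋃_{k=b}^{B} 𝓘_k;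 (iv) T(I) ⊆ I; (v) for every w in the interior of 𝓘_{γ,𝒜} there exists n ∈ ℕ with T^n(w) ∈ I. -/
/-- If a quantity attached to the orbit of `x` is bounded by `C` and gets multiplied by `g > 1` at
each step from which `I` is not reached, then the orbit of `x` reaches `I`. -/
theorem exists_iterate_mem_of_expanding {X : Type*} (T : X → X) (I : Set X) (Q : X → ℝ → Prop)
    {g C : ℝ} (hg : 1 < g) (hQ : ∀ x c, Q x c → c ≤ C)
    (step : ∀ x c, Q x c → (∃ n : ℕ, T^[n] x ∈ I) ∨ Q (T x) (g * c))
    {x : X} {c : ℝ} (hc : 0 < c) (hx : Q x c) : ∃ n : ℕ, T^[n] x ∈ I := by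
  by_contra hne
  have h : ∀ n : ℕ, Q (T^[n] x) (g ^ n * c) := by
    intro n
    induction n with
    | zero => simpa using hx
    | succ n ih =>
      rcases step _ _ ih with ⟨m, hm⟩ | h
      · exact absurd ⟨m + n, by rwa [Function.iterate_add_apply]⟩ hne
      · rwa [Function.iterate_succ_apply', pow_succ', mul_assoc]
  obtain ⟨n, hn⟩ := pow_unbounded_of_one_lt (C / c) hg
  rw [div_lt_iff₀ hc] at hn
  exact absurd (hQ _ _ (h n)) (not_le.mpr hn)

/-- The endpoint relations of the digit transformation in a positive base. -/
theorem digit_endpoints_of_one_lt {γ a A b B ℓ r L : ℝ} (h : 1 < γ) (hab : a ≤ b) (hBA : B ≤ A)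
    (hBb : γ < B - b + 1) (hℓ : ℓ = a * γ / (γ - 1)) (hr : r = A * γ / (γ - 1))
    (hL : L = b / (γ - 1)) :
    γ * L = L + b ∧ γ * (ℓ - a) = ℓ ∧ γ * (r - A) = r ∧ ℓ ≤ L + a ∧ L + b + γ ≤ r := by
  have h1 : 0 < γ - 1 := by linarith
  have h2 : (γ - 1) * ℓ = a * γ := by rw [hℓ]; field_simp
  have h3 : (γ - 1) * r = A * γ := by rw [hr]; field_simp
  have h4 : (γ - 1) * L = b := by rw [hL]; field_simp
  refine ⟨by linarith, by linarith, by linarith, ?_, ?_⟩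
  · refine le_of_mul_le_mul_left ?_ h1
    linarith
  · refine le_of_mul_le_mul_left ?_ h1
    nlinarith

/-- The endpoint relations of the digit transformation in a negative base. -/
theorem digit_endpoints_of_lt_neg_one {γ a A b B ℓ r L : ℝ} (h : γ < -1) (hab : a ≤ b)
    (hBA : B ≤ A) (hBb : -γ < B - b + 1) (hℓ : ℓ = (A + a * γ) * γ / (γ ^ 2 - 1))
    (hr : r = (a + A * γ) * γ / (γ ^ 2 - 1)) (hL : L = (b - γ) / (γ - 1)) :
    γ * L = L + b - γ ∧ γ * (ℓ - a) = r ∧ γ * (r - A) = ℓ ∧ ℓ ≤ L + a ∧ L + 1 + A ≤ r := by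
  have h1 : 0 < γ ^ 2 - 1 := by nlinarith
  have h1' : γ - 1 ≠ 0 := by linarith
  have h2 : (γ ^ 2 - 1) * ℓ = (A + a * γ) * γ := by rw [hℓ]; field_simp
  have h3 : (γ ^ 2 - 1) * r = (a + A * γ) * γ := by rw [hr]; field_simp
  have h4 : (γ - 1) * L = b - γ := by rw [hL]; field_simp
  have h5 : (γ ^ 2 - 1) * L = (b - γ) * (γ + 1) := by rw [← h4]; ring
  refine ⟨by linarith, ?_, ?_, ?_, ?_⟩
  · refine mul_left_cancel₀ h1.ne' ?_
    linear_combination γ * h2 - h3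
  · refine mul_left_cancel₀ h1.ne' ?_
    linear_combination γ * h3 - h2
  · refine le_of_mul_le_mul_left ?_ h1
    nlinarith [mul_nonneg (show 0 ≤ -γ by linarith) (show 0 ≤ A - b + 1 + γ by linarith)]
  · refine le_of_mul_le_mul_left ?_ h1
    nlinarith [mul_nonneg (show 0 ≤ -γ - 1 by linarith) (show 0 ≤ A - b + 1 + γ by linarith),
      mul_nonneg (mul_nonneg (show 0 ≤ -γ by linarith) (show 0 ≤ -γ - 1 by linarith))
        (show 0 ≤ b - a by linarith)]

/-- Lemma on the attractor of the digit transformation `T(w) = γ(w - D(w))` on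
`𝓘_{γ,𝒜} = [ℓ, r]`, with digit intervals `J k` and attractor `I = γ·[L, L+1)`. -/
theorem digit_transformation_attractor (γ : ℝ) (a A b B : ℤ) (ℓ r L : ℝ)
    (hγ : 1 < |γ|) (ha : a ≤ 0) (hA : 0 ≤ A)
    (hsize : (A : ℝ) - (a : ℝ) > |γ| - 1)
    (hab : a ≤ b) (hb0 : b ≤ 0) (hB0 : 0 ≤ B) (hBA : B ≤ A)
    (hBb : B - b = ⌊|γ|⌋)
    (hpos : 1 < γ →
      ℓ = (a : ℝ) * γ / (γ - 1) ∧ r = (A : ℝ) * γ / (γ - 1) ∧ L = (b : ℝ) / (γ - 1))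
    (hneg : γ < -1 →
      ℓ = ((A : ℝ) + (a : ℝ) * γ) * γ / (γ ^ 2 - 1) ∧
      r = ((a : ℝ) + (A : ℝ) * γ) * γ / (γ ^ 2 - 1) ∧
      L = ((b : ℝ) - γ) / (γ - 1))
    (hord : ℓ < L + (a : ℝ) + 1 ∧ L + (a : ℝ) + 1 ≤ L + (A : ℝ) ∧ L + (A : ℝ) < r)
    (J : ℤ → Set ℝ)
    (hJa : J a = Set.Ico ℓ (L + (a : ℝ) + 1))
    (hJA : J A = Set.Icc (L + (A : ℝ)) r)
    (hJmid : ∀ k : ℤ, a < k → k < A → J k = Set.Ico (L + (k : ℝ)) (L + (k : ℝ) + 1))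
    (D : ℝ → ℤ)
    (hD : ∀ k : ℤ, a ≤ k → k ≤ A → ∀ w ∈ J k, D w = k)
    (T : ℝ → ℝ) (hT : ∀ w, T w = γ * (w - (D w : ℝ)))
    (I : Set ℝ) (hI : I = (fun x => γ * x) '' Set.Ico L (L + 1)) :
    (∀ w ∈ Set.Icc ℓ r, T w ∈ Set.Icc ℓ r) ∧
    (∀ k : ℤ, a < k → k < A → ∀ w ∈ J k, T w ∈ I) ∧
    (I ⊆ ⋃ k ∈ Set.Icc b B, J k) ∧
    (∀ w ∈ I, T w ∈ I) ∧
    (∀ w ∈ Set.Ioo ℓ r, ∃ n : ℕ, T^[n] w ∈ I) := by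
  obtain ⟨ho1, ho2, ho3⟩ := hord
  have haA : a + 1 ≤ A := by
    have h : ((a + 1 : ℤ) : ℝ) ≤ A := by push_cast; linarith
    exact_mod_cast h
  have hfl : |γ| < (B : ℝ) - b + 1 := by
    have h := Int.lt_floor_add_one |γ|
    rw [← hBb] at h
    exact_mod_cast h
  have hfl' : (B : ℝ) - b ≤ |γ| := by
    have h := Int.floor_le |γ|
    rw [← hBb] at h
    exact_mod_cast h
  have hbB : b + 1 ≤ B := by
    have h : 1 ≤ ⌊|γ|⌋ := Int.le_floor.mpr (by exact_mod_cast hγ.le)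
    omega
  have hab' : (a : ℝ) ≤ b := by exact_mod_cast hab
  have hBA' : (B : ℝ) ≤ A := by exact_mod_cast hBA
  have hbB' : (b : ℝ) + 1 ≤ B := by exact_mod_cast hbB
  have hmul : ∀ x, L ≤ x → x < L + 1 → γ * x ∈ I := fun x h1 h2 => by
    rw [hI]; exact ⟨x, ⟨h1, h2⟩, rfl⟩
  have key : (∀ x ∈ I, L + b ≤ x ∧ x < L + B + 1 ∧ ℓ ≤ x ∧ x ≤ r) ∧
      (∀ w, ℓ ≤ w → w < L + a + 1 → (ℓ ≤ γ * (w - a) ∧ γ * (w - a) ≤ r) ∧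
        (γ * (w - a) ∈ I ∨ (γ * (w - a) < L + A ∧ γ * (w - a) - ℓ = |γ| * (w - ℓ)) ∨
          (L + a + 1 ≤ γ * (w - a) ∧ r - γ * (w - a) = |γ| * (w - ℓ)))) ∧
      (∀ w, L + A ≤ w → w ≤ r → (ℓ ≤ γ * (w - A) ∧ γ * (w - A) ≤ r) ∧
        (γ * (w - A) ∈ I ∨ (γ * (w - A) < L + A ∧ γ * (w - A) - ℓ = |γ| * (r - w)) ∨
          (L + a + 1 ≤ γ * (w - A) ∧ r - γ * (w - A) = |γ| * (r - w)))) := by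
    rcases lt_abs.mp hγ with h | h
    · have h0 : 0 < γ := by linarith
      rw [abs_of_pos h0] at hfl hfl' ⊢
      obtain ⟨hℓ, hr, hL⟩ := hpos h
      obtain ⟨e1, e2, e3, e4, e5⟩ := digit_endpoints_of_one_lt h hab' hBA' hfl hℓ hr hL
      refine ⟨?_, ?_, ?_⟩
      · rw [hI]
        rintro _ ⟨y, ⟨hy1, hy2⟩, rfl⟩
        have i1 := mul_le_mul_of_nonneg_left hy1 h0.le
        have i2 := mul_lt_mul_of_pos_left hy2 h0
        refine ⟨?_, ?_, ?_, ?_⟩ <;> dsimp only <;> linarith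
      · intro w h1 h2
        have i1 := mul_le_mul_of_nonneg_left h1 h0.le
        have i2 := mul_lt_mul_of_pos_left h2 h0
        refine ⟨⟨by linarith, by linarith⟩, ?_⟩
        rcases le_or_gt L (w - a) with hc | hc
        · exact Or.inl (hmul _ hc (by linarith))
        · have i3 := mul_lt_mul_of_pos_left hc h0
          exact Or.inr (Or.inl ⟨by linarith, by linarith⟩)
      · intro w h1 h2
        have i1 := mul_le_mul_of_nonneg_left h1 h0.le
        have i2 := mul_le_mul_of_nonneg_left h2 h0.le
        refine ⟨⟨by linarith, by linarith⟩, ?_⟩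
        rcases lt_or_ge (w - A) (L + 1) with hc | hc
        · exact Or.inl (hmul _ (by linarith) hc)
        · have i3 := mul_le_mul_of_nonneg_left hc h0.le
          exact Or.inr (Or.inr ⟨by linarith, by linarith⟩)
    · have h0 : γ < 0 := by linarith
      rw [abs_of_neg h0] at hfl hfl' ⊢
      obtain ⟨hℓ, hr, hL⟩ := hneg (by linarith)
      obtain ⟨e1, e2, e3, e4, e5⟩ :=
        digit_endpoints_of_lt_neg_one (by linarith) hab' hBA' hfl hℓ hr hL
      have j1 := mul_le_mul_of_nonpos_left e4 h0.le
      have j2 := mul_le_mul_of_nonpos_left e5 h0.le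
      refine ⟨?_, ?_, ?_⟩
      · rw [hI]
        rintro _ ⟨y, ⟨hy1, hy2⟩, rfl⟩
        have i1 := mul_le_mul_of_nonpos_left hy1 h0.le
        have i2 := mul_lt_mul_of_neg_left hy2 h0
        refine ⟨?_, ?_, ?_, ?_⟩ <;> dsimp only <;> linarith
      · intro w h1 h2
        have i1 := mul_le_mul_of_nonpos_left h1 h0.le
        have i2 := mul_lt_mul_of_neg_left h2 h0
        refine ⟨⟨by linarith, by linarith⟩, ?_⟩
        rcases le_or_gt L (w - a) with hc | hc
        · exact Or.inl (hmul _ hc (by linarith))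
        · have i3 := mul_lt_mul_of_neg_left hc h0
          exact Or.inr (Or.inr ⟨by linarith, by linarith⟩)
      · intro w h1 h2
        have i1 := mul_le_mul_of_nonpos_left h1 h0.le
        have i2 := mul_le_mul_of_nonpos_left h2 h0.le
        refine ⟨⟨by linarith, by linarith⟩, ?_⟩
        rcases lt_or_ge (w - A) (L + 1) with hc | hc
        · exact Or.inl (hmul _ (by linarith) hc)
        · have i3 := mul_le_mul_of_nonpos_left hc h0.le
          exact Or.inr (Or.inl ⟨by linarith, by linarith⟩)
  obtain ⟨hbd, hlow, hhigh⟩ := key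
  have hmid : ∀ w, L + D w ≤ w → w < L + D w + 1 → T w ∈ I := fun w h1 h2 => by
    rw [hT]; exact hmul _ (by linarith) (by linarith)
  have hJmem : ∀ (k : ℤ) (w : ℝ), a ≤ k → k ≤ A → ℓ ≤ w → w ≤ r → L + k ≤ w →
      w < L + k + 1 → w ∈ J k := by
    intro k w hk1 hk2 h1 h2 h3 h4
    rcases hk1.eq_or_lt with rfl | hk1
    · rw [hJa]; exact ⟨h1, h4⟩
    rcases hk2.eq_or_lt with rfl | hk2
    · rw [hJA]; exact ⟨h3, h2⟩
    · rw [hJmid k hk1 hk2]; exact ⟨h3, h4⟩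
  have hdigit : ∀ w, ℓ ≤ w → w ≤ r → (D w = a ∧ w < L + a + 1) ∨ (D w = A ∧ L + A ≤ w) ∨
      (L + D w ≤ w ∧ w < L + D w + 1) := by
    intro w h1 h2
    rcases lt_or_ge w (L + a + 1) with h3 | h3
    · exact Or.inl ⟨hD a le_rfl (by omega) w (by rw [hJa]; exact ⟨h1, h3⟩), h3⟩
    rcases le_or_gt (L + A) w with h4 | h4
    · exact Or.inr (Or.inl ⟨hD A (by omega) le_rfl w (by rw [hJA]; exact ⟨h4, h2⟩), h4⟩)
    have f1 := Int.floor_le (w - L)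
    have f2 := Int.lt_floor_add_one (w - L)
    have k1 : a ≤ ⌊w - L⌋ := Int.le_floor.mpr (by linarith)
    have k2 : ⌊w - L⌋ ≤ A := (Int.floor_lt.mpr (by linarith)).le
    have hk := hD _ k1 k2 w (hJmem _ w k1 k2 h1 h2 (by linarith) (by linarith))
    rw [hk]
    exact Or.inr (Or.inr ⟨by linarith, by linarith⟩)
  have hcover : ∀ x ∈ I, ∃ k : ℤ, b ≤ k ∧ k ≤ B ∧ L + k ≤ x ∧ x < L + k + 1 ∧ x ∈ J k := by
    intro x hx
    obtain ⟨h1, h2, h3, h4⟩ := hbd x hx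
    have f1 := Int.floor_le (x - L)
    have f2 := Int.lt_floor_add_one (x - L)
    have k1 : b ≤ ⌊x - L⌋ := Int.le_floor.mpr (by linarith)
    have k2 : ⌊x - L⌋ ≤ B :=
      Int.lt_add_one_iff.mp (Int.floor_lt.mpr (by push_cast; linarith))
    exact ⟨_, k1, k2, by linarith, by linarith,
      hJmem _ x (hab.trans k1) (k2.trans hBA) h3 h4 (by linarith) (by linarith)⟩
  have hmaps : ∀ w ∈ Set.Icc ℓ r, T w ∈ Set.Icc ℓ r := by
    rintro w ⟨h1, h2⟩
    rcases hdigit w h1 h2 with ⟨hd, h3⟩ | ⟨hd, h3⟩ | ⟨h3, h4⟩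
    · rw [hT, hd]; exact (hlow w h1 h3).1
    · rw [hT, hd]; exact (hhigh w h3 h2).1
    · exact (hbd _ (hmid w h3 h4)).2.2
  refine ⟨hmaps, ?_, ?_, ?_, ?_⟩
  · intro k hk1 hk2 w hw
    have hd := hD k hk1.le hk2.le w hw
    rw [hJmid k hk1 hk2] at hw
    exact hmid w (hd ▸ hw.1) (hd ▸ hw.2)
  · intro x hx
    obtain ⟨k, k1, k2, -, -, hk⟩ := hcover x hx
    exact Set.mem_biUnion (Set.mem_Icc.mpr ⟨k1, k2⟩) hk
  · intro x hx
    obtain ⟨k, k1, k2, h1, h2, hk⟩ := hcover x hx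
    have hd := hD k (hab.trans k1) (k2.trans hBA) x hk
    exact hmid x (hd ▸ h1) (hd ▸ h2)
  · rintro w ⟨hw1, hw2⟩
    let Q : ℝ → ℝ → Prop := fun x c => x ∈ Set.Icc ℓ r ∧
      ((x < L + a + 1 ∧ D x = a ∧ c ≤ x - ℓ) ∨ (L + A ≤ x ∧ D x = A ∧ c ≤ r - x))
    have hQ : ∀ x c, Q x c → c ≤ r - ℓ := by
      rintro x c ⟨⟨h1, h2⟩, ⟨-, -, h⟩ | ⟨-, -, h⟩⟩ <;> linarith
    have hnext : ∀ x ∈ Set.Icc ℓ r, ∀ c, (T x ∈ I ∨ (T x < L + A ∧ c ≤ T x - ℓ) ∨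
        (L + a + 1 ≤ T x ∧ c ≤ r - T x)) → (∃ n : ℕ, T^[n] x ∈ I) ∨ Q (T x) c := by
      intro x hx c h
      have hTx := hmaps x hx
      rcases h with h | h
      · exact Or.inl ⟨1, h⟩
      rcases hdigit _ hTx.1 hTx.2 with ⟨hd, h3⟩ | ⟨hd, h3⟩ | ⟨h3, h4⟩
      · rcases h with h | h
        · exact Or.inr ⟨hTx, Or.inl ⟨h3, hd, h.2⟩⟩
        · exact absurd h.1 (not_le.mpr h3)
      · rcases h with h | h
        · exact absurd h.1 (not_lt.mpr h3)
        · exact Or.inr ⟨hTx, Or.inr ⟨h3, hd, h.2⟩⟩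
      · exact Or.inl ⟨2, hmid _ h3 h4⟩
    have step : ∀ x c, Q x c → (∃ n : ℕ, T^[n] x ∈ I) ∨ Q (T x) (|γ| * c) := by
      rintro x c ⟨hx, ⟨h, hd, hc⟩ | ⟨h, hd, hc⟩⟩
      · have hm := mul_le_mul_of_nonneg_left hc (abs_nonneg γ)
        refine hnext x hx _ ?_
        rw [hT, hd]
        exact (hlow x hx.1 h).2.imp_right
          (Or.imp (fun e => ⟨e.1, hm.trans e.2.ge⟩) (fun e => ⟨e.1, hm.trans e.2.ge⟩))
      · have hm := mul_le_mul_of_nonneg_left hc (abs_nonneg γ)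
        refine hnext x hx _ ?_
        rw [hT, hd]
        exact (hhigh x h hx.2).2.imp_right
          (Or.imp (fun e => ⟨e.1, hm.trans e.2.ge⟩) (fun e => ⟨e.1, hm.trans e.2.ge⟩))
    rcases hdigit w hw1.le hw2.le with ⟨hd, h3⟩ | ⟨hd, h3⟩ | ⟨h3, h4⟩
    · exact exists_iterate_mem_of_expanding T I Q hγ hQ step (sub_pos.mpr hw1)
        ⟨⟨hw1.le, hw2.le⟩, Or.inl ⟨h3, hd, le_rfl⟩⟩
    · exact exists_iterate_mem_of_expanding T I Q hγ hQ step (sub_pos.mpr hw2)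
        ⟨⟨hw1.le, hw2.le⟩, Or.inr ⟨h3, hd, le_rfl⟩⟩
    · exact ⟨1, hmid w h3 h4⟩
end

section
/- Let β be a quadratic Pisot unit, let 𝒜 ∋ 0 be a finite set of consecutive integers with #𝒜 > β and {−1, 0, 1} ⊆ 𝒜, and set γ = 1/β′ where β′ is the Galois conjugate of β. Let Ω be the interior of 𝓘_{γ,𝒜} together with the point 0. Then X^𝒜(β) = Σ_β(Ω). -/
/-- The spectrum `X^𝒜(α)` with digit alphabet `𝒜 = {a, a+1, …, A} ⊂ ℤ`. -/
def XspecZ (α : ℝ) (a A : ℤ) : Set ℝ :=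
  {x | ∃ (n : ℕ) (c : ℕ → ℤ), (∀ j ≤ n, a ≤ c j ∧ c j ≤ A) ∧
    x = ∑ j ∈ Finset.range (n + 1), (c j : ℝ) * α ^ j}

/-- The cut-and-project set `Σ_β(Ω) = { x ∈ ℤ + ℤβ : x′ ∈ Ω }`, where `x′ = a + bβ′`
for `x = a + bβ`. -/
def sigmaCP (β β' : ℝ) (Ω : Set ℝ) : Set ℝ :=
  {x | ∃ a b : ℤ, x = (a : ℝ) + (b : ℝ) * β ∧ (a : ℝ) + (b : ℝ) * β' ∈ Ω}

/-- The set `𝓘_{γ,𝒜}` of real numbers having a `(γ,𝒜)`-representation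
`w = ∑_{i=0}^∞ D_i / γ^i` with digits `D_i ∈ {a,…,A}`. -/
def repInterval (γ : ℝ) (a A : ℤ) : Set ℝ :=
  {w | ∃ D : ℕ → ℤ, (∀ i, a ≤ D i ∧ D i ≤ A) ∧ w = ∑' i : ℕ, (D i : ℝ) / γ ^ i}

theorem exists_int_mem_Icc_mem_Ioo {a A : ℤ} {u v : ℝ} (haA : a ≤ A) (huv : 1 < v - u)
    (hu : u < A) (hv : (a : ℝ) < v) : ∃ D : ℤ, a ≤ D ∧ D ≤ A ∧ u < D ∧ (D : ℝ) < v := by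
  have h1 := Int.lt_floor_add_one u
  have h2 := Int.floor_le u
  by_cases h : ⌊u⌋ + 1 ≤ a
  · refine ⟨a, le_rfl, haA, ?_, hv⟩
    have : ((⌊u⌋ + 1 : ℤ) : ℝ) ≤ a := by exact_mod_cast h
    push_cast at this
    linarith
  · have h3 : ⌊u⌋ < A := Int.floor_lt.2 hu
    refine ⟨⌊u⌋ + 1, by lia, by lia, ?_, ?_⟩ <;> push_cast <;> linarith

/-- The open interval `(L, R)` is mapped by `s ↦ D + b * s`, `D ∈ {a,…,A}`, onto a set covering
`(a + min (bL) (bR), A + max (bL) (bR))`. -/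
theorem exists_digit_of_mem {a A : ℤ} {b L R z : ℝ} (haA : a ≤ A) (hb : b ≠ 0)
    (hlen : 1 < |b| * (R - L)) (hz : a + min (b * L) (b * R) < z)
    (hz' : z < A + max (b * L) (b * R)) :
    ∃ D : ℤ, a ≤ D ∧ D ≤ A ∧ ∃ s, L < s ∧ s < R ∧ z = D + b * s := by
  have hbL : ∀ D : ℤ, z = D + b * ((z - D) / b) := fun D => by field_simp; ring
  rcases lt_or_gt_of_ne hb with h | h
  · have hLR : L < R := by
      rw [abs_of_neg h] at hlen
      nlinarith
    have hle : b * R ≤ b * L := by nlinarith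
    rw [abs_of_neg h] at hlen
    rw [min_eq_right hle] at hz
    rw [max_eq_left hle] at hz'
    obtain ⟨D, h1, h2, h3, h4⟩ := exists_int_mem_Icc_mem_Ioo (u := z - b * L) (v := z - b * R) haA
      (by linarith) (by linarith) (by linarith)
    refine ⟨D, h1, h2, (z - D) / b, ?_, ?_, hbL D⟩
    · rw [lt_div_iff_of_neg h]; linarith
    · rw [div_lt_iff_of_neg h]; linarith
  · have hLR : L < R := by
      rw [abs_of_pos h] at hlen
      nlinarith
    have hle : b * L ≤ b * R := by nlinarith
    rw [abs_of_pos h] at hlen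
    rw [min_eq_left hle] at hz
    rw [max_eq_right hle] at hz'
    obtain ⟨D, h1, h2, h3, h4⟩ := exists_int_mem_Icc_mem_Ioo (u := z - b * R) (v := z - b * L) haA
      (by linarith) (by linarith) (by linarith)
    refine ⟨D, h1, h2, (z - D) / b, ?_, ?_, hbL D⟩
    · rw [lt_div_iff₀ h]; linarith
    · rw [div_lt_iff₀ h]; linarith

/-- `l` and `r` are the endpoints of the attractor of the maps `s ↦ D + b * s`,
`D ∈ {a,…,A}`. -/
structure IsEndpoints (b : ℝ) (a A : ℤ) (l r : ℝ) : Prop where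
  neg : l < 0
  pos : 0 < r
  left : l = a + min (b * l) (b * r)
  right : r = A + max (b * l) (b * r)

theorem exists_isEndpoints {b : ℝ} {a A : ℤ} (hb1 : |b| < 1) (ha : a ≤ -1) (hA : 1 ≤ A) :
    ∃ l r, IsEndpoints b a A l r := by
  have ha' : (a : ℝ) ≤ -1 := by exact_mod_cast ha
  have hA' : (1 : ℝ) ≤ A := by exact_mod_cast hA
  obtain ⟨h1, h2⟩ := abs_lt.1 hb1
  rcases le_total 0 b with h | h
  · have h0 : 0 < 1 - b := by linarith
    have hl : (a : ℝ) / (1 - b) < 0 := div_neg_of_neg_of_pos (by linarith) h0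
    have hr : 0 < (A : ℝ) / (1 - b) := by positivity
    have hle : b * (a / (1 - b)) ≤ b * (A / (1 - b)) :=
      mul_le_mul_of_nonneg_left (by linarith) h
    refine ⟨a / (1 - b), A / (1 - b), hl, hr, ?_, ?_⟩
    · rw [min_eq_left hle]; field_simp; ring
    · rw [max_eq_right hle]; field_simp; ring
  · have h0 : 0 < 1 - b ^ 2 := by nlinarith
    have hl : (a + b * A) / (1 - b ^ 2) < 0 := div_neg_of_neg_of_pos (by nlinarith) h0
    have hr : 0 < (A + b * a) / (1 - b ^ 2) := div_pos (by nlinarith) h0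
    have hle : b * ((A + b * a) / (1 - b ^ 2)) ≤ b * ((a + b * A) / (1 - b ^ 2)) :=
      mul_le_mul_of_nonpos_left (by linarith) h
    refine ⟨(a + b * A) / (1 - b ^ 2), (A + b * a) / (1 - b ^ 2), hl, hr, ?_, ?_⟩
    · rw [min_eq_right hle]; field_simp; ring
    · rw [max_eq_left hle]; field_simp; ring

namespace IsEndpoints

variable {b l r : ℝ} {a A : ℤ}

theorem sub_eq (h : IsEndpoints b a A l r) : (r - l) * (1 - |b|) = A - a := by
  have hlr : l < r := h.neg.trans h.pos
  have h1 := h.left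
  have h2 := h.right
  rcases le_total 0 b with hb | hb
  · rw [min_eq_left (by nlinarith)] at h1
    rw [max_eq_right (by nlinarith)] at h2
    rw [abs_of_nonneg hb]
    linarith
  · rw [min_eq_right (by nlinarith)] at h1
    rw [max_eq_left (by nlinarith)] at h2
    rw [abs_of_nonpos hb]
    linarith

theorem one_lt (h : IsEndpoints b a A l r) {β : ℝ} (hβ : 1 < β) (hb : |b| * β = 1)
    (hcard : β < (A : ℝ) - a + 1) : 1 < |b| * (r - l) := by
  have h1 := h.sub_eq
  have h2 : |b| = 1 / β := by field_simp; linarith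
  rw [h2] at h1 ⊢
  field_simp at h1 ⊢
  nlinarith

theorem mem_Ioo (h : IsEndpoints b a A l r) (hb : b ≠ 0) {d : ℤ} (hd : a ≤ d) (hd' : d ≤ A)
    {s : ℝ} (hs : s ∈ Set.Ioo l r) : (d : ℝ) + b * s ∈ Set.Ioo l r := by
  obtain ⟨hs1, hs2⟩ := hs
  have h1 := h.left
  have h2 := h.right
  have hd1 : (a : ℝ) ≤ d := by exact_mod_cast hd
  have hd2 : (d : ℝ) ≤ A := by exact_mod_cast hd'
  rcases lt_or_gt_of_ne hb with hb | hb
  · rw [min_eq_right (by nlinarith)] at h1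
    rw [max_eq_left (by nlinarith)] at h2
    constructor <;> nlinarith
  · rw [min_eq_left (by nlinarith)] at h1
    rw [max_eq_right (by nlinarith)] at h2
    constructor <;> nlinarith

theorem sum_mem_Ioo (h : IsEndpoints b a A l r) (hb : b ≠ 0) (n : ℕ) (c : ℕ → ℤ)
    (hc : ∀ j < n, a ≤ c j ∧ c j ≤ A) :
    ∑ j ∈ Finset.range n, (c j : ℝ) * b ^ j ∈ Set.Ioo l r := by
  induction n generalizing c with
  | zero => simpa using ⟨h.neg, h.pos⟩
  | succ n ih =>
    have h1 := ih (fun j => c (j + 1)) (fun j hj => hc (j + 1) (by lia))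
    have h2 := h.mem_Ioo hb (hc 0 (by lia)).1 (hc 0 (by lia)).2 h1
    rw [Finset.sum_range_succ']
    convert h2 using 1
    rw [Finset.mul_sum, add_comm]
    simp only [pow_zero, mul_one]
    congr 1
    exact Finset.sum_congr rfl fun j _ => by ring

theorem summable (hb1 : |b| < 1) {D : ℕ → ℤ} (hD : ∀ i, a ≤ D i ∧ D i ≤ A) :
    Summable fun i => (D i : ℝ) * b ^ i := by
  refine Summable.of_norm_bounded (g := fun i => (|(a : ℝ)| + |(A : ℝ)|) * |b| ^ i)
    ((summable_geometric_of_lt_one (abs_nonneg b) hb1).mul_left _) fun i => ?_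
  rw [Real.norm_eq_abs, abs_mul, abs_pow]
  have h1 : (a : ℝ) ≤ D i := by exact_mod_cast (hD i).1
  have h2 : (D i : ℝ) ≤ A := by exact_mod_cast (hD i).2
  gcongr
  rw [abs_le]
  constructor
  · linarith [neg_abs_le (a : ℝ), abs_nonneg (A : ℝ)]
  · linarith [le_abs_self (A : ℝ), abs_nonneg (a : ℝ)]

theorem repInterval_subset (h : IsEndpoints b a A l r) (hb : b ≠ 0) (hb1 : |b| < 1) :
    repInterval (1 / b) a A ⊆ Set.Icc l r := by
  rintro w ⟨D, hD, rfl⟩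
  have he : (fun i => (D i : ℝ) / (1 / b) ^ i) = fun i => (D i : ℝ) * b ^ i := by
    funext i
    simp [div_eq_mul_inv]
  rw [he]
  exact isClosed_Icc.mem_of_tendsto (summable hb1 hD).hasSum.tendsto_sum_nat
    (Filter.Eventually.of_forall fun n =>
      Set.Ioo_subset_Icc_self (h.sum_mem_Ioo hb n D fun j _ => hD j))

theorem subset_repInterval (h : IsEndpoints b a A l r) (hb : b ≠ 0) (hb1 : |b| < 1)
    (haA : a ≤ A) (hlen : 1 < |b| * (r - l)) : Set.Ioo l r ⊆ repInterval (1 / b) a A := by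
  intro w hw
  have hstep : ∀ z : Set.Ioo l r, ∃ D : ℤ, ∃ s : Set.Ioo l r,
      a ≤ D ∧ D ≤ A ∧ (z : ℝ) = D + b * s := by
    rintro ⟨z, hz1, hz2⟩
    obtain ⟨D, h1, h2, s, h3, h4, h5⟩ := exists_digit_of_mem (z := z) haA hb hlen
      (by rw [← h.left]; exact hz1) (by rw [← h.right]; exact hz2)
    exact ⟨D, ⟨s, h3, h4⟩, h1, h2, h5⟩
  choose d T hd1 hd2 hT using hstep
  have hD : ∀ i, a ≤ d (T^[i] ⟨w, hw⟩) ∧ d (T^[i] ⟨w, hw⟩) ≤ A := fun i => ⟨hd1 _, hd2 _⟩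
  have hpart : ∀ n, ∑ i ∈ Finset.range n, (d (T^[i] ⟨w, hw⟩) : ℝ) * b ^ i
      = w - b ^ n * (T^[n] ⟨w, hw⟩ : Set.Ioo l r) := by
    intro n
    induction n with
    | zero => simp
    | succ n ih =>
      rw [Finset.sum_range_succ, ih, Function.iterate_succ_apply', hT (T^[n] ⟨w, hw⟩)]
      ring
  refine ⟨fun i => d (T^[i] ⟨w, hw⟩), hD, ?_⟩
  have he : (fun i => (d (T^[i] ⟨w, hw⟩) : ℝ) / (1 / b) ^ i)
      = fun i => (d (T^[i] ⟨w, hw⟩) : ℝ) * b ^ i := by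
    funext i
    simp [div_eq_mul_inv]
  rw [he]
  refine tendsto_nhds_unique ?_ (summable hb1 hD).hasSum.tendsto_sum_nat
  simp_rw [hpart]
  have hz : Filter.Tendsto (fun n => b ^ n * ((T^[n] ⟨w, hw⟩ : Set.Ioo l r) : ℝ))
      Filter.atTop (nhds 0) := by
    refine squeeze_zero_norm (a := fun n => |b| ^ n * (|l| + |r|)) (fun n => ?_) ?_
    · rw [Real.norm_eq_abs, abs_mul, abs_pow]
      have h1 := (T^[n] ⟨w, hw⟩).2.1
      have h2 := (T^[n] ⟨w, hw⟩).2.2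
      gcongr
      rw [abs_le]
      constructor
      · linarith [neg_abs_le l, abs_nonneg r]
      · linarith [le_abs_self r, abs_nonneg l]
    · simpa using (tendsto_pow_atTop_nhds_zero_of_lt_one (abs_nonneg b) hb1).mul_const (|l| + |r|)
  simpa using hz.const_sub w

theorem interior_repInterval (h : IsEndpoints b a A l r) (hb : b ≠ 0) (hb1 : |b| < 1)
    (haA : a ≤ A) (hlen : 1 < |b| * (r - l)) :
    interior (repInterval (1 / b) a A) = Set.Ioo l r := by
  apply Set.Subset.antisymm
  · exact (interior_mono (h.repInterval_subset hb hb1)).trans interior_Icc.subset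
  · exact interior_maximal (h.subset_repInterval hb hb1 haA hlen) isOpen_Ioo

end IsEndpoints

theorem intCast_mem_XspecZ (β : ℝ) {a A d : ℤ} (h : a ≤ d) (h' : d ≤ A) :
    (d : ℝ) ∈ XspecZ β a A :=
  ⟨0, fun _ => d, fun _ _ => ⟨h, h'⟩, by simp⟩

theorem add_mul_mem_XspecZ {β y : ℝ} {a A d : ℤ} (h : a ≤ d) (h' : d ≤ A)
    (hy : y ∈ XspecZ β a A) : (d : ℝ) + β * y ∈ XspecZ β a A := by
  obtain ⟨n, c, hc, rfl⟩ := hy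
  refine ⟨n + 1, fun j => Nat.casesOn j d c, ?_, ?_⟩
  · rintro (_ | j) hj
    · exact ⟨h, h'⟩
    · exact hc j (by lia)
  · rw [Finset.sum_range_succ' _ (n + 1), Finset.mul_sum, add_comm]
    simp only [pow_zero, mul_one]
    congr 1
    exact Finset.sum_congr rfl fun j _ => by ring

theorem XspecZ_mono {β : ℝ} {a A a' A' : ℤ} (h : a' ≤ a) (h' : A ≤ A') :
    XspecZ β a A ⊆ XspecZ β a' A' := by
  rintro _ ⟨n, c, hc, rfl⟩
  exact ⟨n, c, fun j hj => ⟨h.trans (hc j hj).1, (hc j hj).2.trans h'⟩, rfl⟩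

theorem exists_sum_eq_add_mul {β β' : ℝ} {p e : ℤ} (h : β ^ 2 = p * β - e)
    (hconj : β' ^ 2 = p * β' - e) (c : ℕ → ℤ) (n : ℕ) :
    ∃ u v : ℤ, ∑ j ∈ Finset.range n, (c j : ℝ) * β ^ j = u + v * β ∧
      ∑ j ∈ Finset.range n, (c j : ℝ) * β' ^ j = u + v * β' := by
  induction n generalizing c with
  | zero => exact ⟨0, 0, by simp, by simp⟩
  | succ n ih =>
    obtain ⟨u, v, hu, hv⟩ := ih fun j => c (j + 1)
    have hs : ∀ t : ℝ, ∑ j ∈ Finset.range (n + 1), (c j : ℝ) * t ^ j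
        = t * ∑ j ∈ Finset.range n, (c (j + 1) : ℝ) * t ^ j + c 0 := by
      intro t
      rw [Finset.sum_range_succ', Finset.mul_sum]
      simp only [pow_zero, mul_one]
      congr 1
      exact Finset.sum_congr rfl fun j _ => by ring
    refine ⟨c 0 - e * v, u + p * v, ?_, ?_⟩
    · rw [hs, hu]; push_cast; linear_combination (v : ℝ) * h
    · rw [hs, hv]; push_cast; linear_combination (v : ℝ) * hconj

/-- Every element of `Σ_β((L, R))` lies in the spectrum `X^𝒜(β)`. -/
def CoversIoo (β β' : ℝ) (a A : ℤ) (L R : ℝ) : Prop :=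
  ∀ m n : ℤ, L < m + n * β' → m + n * β' < R → (m + n * β : ℝ) ∈ XspecZ β a A

/-- Division with remainder `D` by `β` in `ℤ + ℤβ`, together with its Galois image. -/
theorem exists_sub_div {β β' : ℝ} {p e : ℤ} (he : e * e = 1) (h : β ^ 2 = p * β - e)
    (hβ' : β' = p - β) (m n D : ℤ) :
    ∃ m' n' : ℤ, (m + n * β : ℝ) = D + β * (m' + n' * β) ∧
      (m + n * β' : ℝ) = D + β' * (m' + n' * β') := by
  have he' : (e : ℝ) * e = 1 := by exact_mod_cast he
  refine ⟨n + e * p * (m - D), -(e * (m - D)), ?_, ?_⟩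
  · push_cast
    linear_combination (e * (m - D) : ℝ) * h - (m - D : ℝ) * he'
  · subst hβ'
    push_cast
    linear_combination (e * (m - D) : ℝ) * h - (m - D : ℝ) * he'

theorem CoversIoo.step {β β' : ℝ} {p e a A : ℤ} {L R : ℝ} (he : e * e = 1)
    (h : β ^ 2 = p * β - e) (hβ' : β' = p - β) (hb : β' ≠ 0) (haA : a ≤ A)
    (hlen : 1 < |β'| * (R - L)) (hS : CoversIoo β β' a A L R) :
    CoversIoo β β' a A (a + min (β' * L) (β' * R)) (A + max (β' * L) (β' * R)) := by
  intro m n h1 h2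
  obtain ⟨D, hD, hD', s, hs, hsR, hz⟩ := exists_digit_of_mem haA hb hlen h1 h2
  obtain ⟨m', n', hx, hz'⟩ := exists_sub_div he h hβ' m n D
  have hs2 : s = m' + n' * β' := mul_left_cancel₀ hb (by linarith)
  rw [hx]
  exact add_mul_mem_XspecZ hD hD' (hS m' n' (hs2 ▸ hs) (hs2 ▸ hsR))

/-- If elements whose Galois image lies in some long enough interval are in the spectrum, so are
those whose Galois image lies in the interior of the attractor. -/
theorem CoversIoo.extend {β β' : ℝ} {p e a A : ℤ} {L R l r : ℝ} (he : e * e = 1) (hβ : 1 < β)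
    (h : β ^ 2 = p * β - e) (hβ' : β' = p - β) (habs : |β'| * β = 1)
    (hcard : β < (A : ℝ) - a + 1) (hend : IsEndpoints β' a A l r) (haA : a ≤ A)
    (hlen : 1 < |β'| * (R - L)) (hS : CoversIoo β β' a A L R) :
    CoversIoo β β' a A l r := by
  have hb : β' ≠ 0 := by rintro rfl; simp at habs
  have hb1 : |β'| < 1 := by nlinarith [abs_pos.2 hb]
  have key : ∀ k : ℕ, ∃ L' R', 1 < |β'| * (R' - L') ∧ CoversIoo β β' a A L' R' ∧
      L' - l ≤ |β'| ^ k * max (L - l) (r - R) ∧ r - R' ≤ |β'| ^ k * max (L - l) (r - R) := by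
    intro k
    induction k with
    | zero => exact ⟨L, R, hlen, hS, by simp, by simp⟩
    | succ k ih =>
      obtain ⟨L', R', h1, h2, h3, h4⟩ := ih
      have hlr : l < r := hend.neg.trans hend.pos
      have hl := hend.left
      have hr := hend.right
      have hLR : L' < R' := by nlinarith [abs_pos.2 hb]
      have hpow : |β'| ^ (k + 1) * max (L - l) (r - R)
          = |β'| * (|β'| ^ k * max (L - l) (r - R)) := by ring
      refine ⟨_, _, ?_, h2.step he h hβ' hb haA h1, ?_, ?_⟩
      · have h5 : max (β' * L') (β' * R') - min (β' * L') (β' * R') = |β'| * (R' - L') := by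
          rw [max_sub_min_eq_abs, ← mul_sub, abs_mul, abs_of_pos (sub_pos.2 hLR)]
        nlinarith [abs_pos.2 hb]
      all_goals
        rw [hpow]
        rcases lt_or_gt_of_ne hb with hb | hb
        · rw [min_eq_right (by nlinarith)] at hl
          rw [max_eq_left (by nlinarith)] at hr
          first
          | rw [min_eq_right (by nlinarith)]
          | rw [max_eq_left (by nlinarith)]
          rw [abs_of_neg hb] at *
          nlinarith
        · rw [min_eq_left (by nlinarith)] at hl
          rw [max_eq_right (by nlinarith)] at hr
          first
          | rw [min_eq_left (by nlinarith)]
          | rw [max_eq_right (by nlinarith)]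
          rw [abs_of_pos hb] at *
          nlinarith
  intro m n h1 h2
  have ht : Filter.Tendsto (fun k => |β'| ^ k * max (L - l) (r - R)) Filter.atTop (nhds 0) := by
    simpa using (tendsto_pow_atTop_nhds_zero_of_lt_one (abs_nonneg β') hb1).mul_const
      (max (L - l) (r - R))
  have hpos : 0 < min (m + n * β' - l) (r - (m + n * β')) := lt_min (by linarith) (by linarith)
  obtain ⟨k, hk⟩ := (ht.eventually_lt_const hpos).exists
  obtain ⟨hk1, hk2⟩ := lt_min_iff.1 hk
  obtain ⟨L', R', -, h4, h5, h6⟩ := key k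
  exact h4 m n (by linarith) (by linarith)

/-- Repeated division contracts `|x|` until it drops below any bound `t > M / (β - 1)`, where `M`
bounds the digits. -/
theorem coversIoo_of_abs_lt {β β' : ℝ} {p e a A : ℤ} {l r M t : ℝ} (he : e * e = 1) (hβ : 1 < β)
    (h : β ^ 2 = p * β - e) (hβ' : β' = p - β) (habs : |β'| * β = 1)
    (hcard : β < (A : ℝ) - a + 1) (hend : IsEndpoints β' a A l r) (haA : a ≤ A)
    (ha : -M ≤ a) (hA : A ≤ M) (ht : M < t * (β - 1))
    (hS : ∀ m n : ℤ, l < m + n * β' → m + n * β' < r → |(m + n * β : ℝ)| < t →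
      (m + n * β : ℝ) ∈ XspecZ β a A) :
    CoversIoo β β' a A l r := by
  have hb : β' ≠ 0 := by rintro rfl; simp at habs
  have h0 : 0 < β - 1 := by linarith
  have hu : M / (β - 1) < t := by rwa [div_lt_iff₀ h0]
  have hM : M / (β - 1) * (β - 1) = M := by field_simp
  set u := M / (β - 1)
  have key : ∀ (k : ℕ) (m n : ℤ), l < m + n * β' → m + n * β' < r →
      |(m + n * β : ℝ)| < u + (t - u) * β ^ k → (m + n * β : ℝ) ∈ XspecZ β a A := by
    intro k
    induction k with
    | zero => exact fun m n h1 h2 h3 => hS m n h1 h2 (by simpa using h3)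
    | succ k ih =>
      intro m n h1 h2 h3
      obtain ⟨D, hD, hD', s, hs, hs', hz⟩ := exists_digit_of_mem (z := m + n * β') haA hb
        (hend.one_lt hβ habs hcard) (by rwa [← hend.left]) (by rwa [← hend.right])
      obtain ⟨m', n', hx, hz'⟩ := exists_sub_div he h hβ' m n D
      have hs2 : s = m' + n' * β' := mul_left_cancel₀ hb (by linarith)
      have hD1 : (a : ℝ) ≤ D := by exact_mod_cast hD
      have hD2 : (D : ℝ) ≤ A := by exact_mod_cast hD'
      rw [hx]
      refine add_mul_mem_XspecZ hD hD' (ih m' n' (hs2 ▸ hs) (hs2 ▸ hs') ?_)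
      rw [hx, pow_succ] at h3
      obtain ⟨h4, h5⟩ := abs_lt.1 h3
      rw [abs_lt]
      constructor <;> refine lt_of_mul_lt_mul_left ?_ (by linarith : (0 : ℝ) ≤ β) <;> nlinarith
  intro m n h1 h2
  obtain ⟨k, hk⟩ := pow_unbounded_of_one_lt ((|(m + n * β : ℝ)| - u) / (t - u)) hβ
  rw [div_lt_iff₀ (by linarith)] at hk
  exact key k m n h1 h2 (by linarith)

theorem add_mul_mem_XspecZ_of_abs_le_one {a A m n : ℤ} (β : ℝ) (ha : a ≤ -1) (hA : 1 ≤ A)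
    (hm : -1 ≤ m ∧ m ≤ 1) (hn : -1 ≤ n ∧ n ≤ 1) : (m + n * β : ℝ) ∈ XspecZ β a A := by
  rw [mul_comm]
  exact add_mul_mem_XspecZ (by lia) (by lia) (intCast_mem_XspecZ β (by lia) (by lia))

theorem exists_subalphabet {a A N : ℤ} (ha : a ≤ -1) (hA : 1 ≤ A) (hN : 2 ≤ N)
    (hAa : N ≤ A - a) :
    ∃ a₀ A₀ : ℤ, a ≤ a₀ ∧ A₀ ≤ A ∧ a₀ ≤ -1 ∧ 1 ≤ A₀ ∧ A₀ = a₀ + N ∧ -(N - 1) ≤ a₀ ∧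
      A₀ ≤ N - 1 := by
  rcases le_total a (1 - N) with h | h
  · exact ⟨1 - N, 1, by lia, by lia, by lia, by lia, by lia, by lia, by lia⟩
  · exact ⟨a, a + N, by lia, by lia, by lia, by lia, by lia, by lia, by lia⟩

/-- From symmetric bounds `t` on elements and `B` on their Galois images to the spectrum. -/
theorem coversIoo_of_bounds {β β' : ℝ} {p e a A N : ℤ} {l r t B : ℝ} (he : e * e = 1)
    (hβ : 1 < β) (h : β ^ 2 = p * β - e) (hβ' : β' = p - β) (habs : |β'| * β = 1)
    (ha : a ≤ -1) (hA : 1 ≤ A) (hend : IsEndpoints β' a A l r)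
    (hN : 2 ≤ N) (hAa : N ≤ A - a) (hNβ : β < N + 1) (ht : N - 1 < t * (β - 1))
    (hB : ∀ (a₀ A₀ : ℤ) (l₀ r₀ : ℝ), A₀ = a₀ + N → -(N - 1) ≤ a₀ → A₀ ≤ N - 1 →
      IsEndpoints β' a₀ A₀ l₀ r₀ → -B ≤ l₀ ∧ r₀ ≤ B)
    (hS : ∀ m n : ℤ, 1 ≤ n → -B < m + n * β' → |(m + n * β : ℝ)| < t →
      n = 1 ∧ -1 ≤ m ∧ m ≤ 1) (ht2 : t ≤ 2) :
    CoversIoo β β' a A l r := by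
  have hb : β' ≠ 0 := by rintro rfl; simp at habs
  have hb1 : |β'| < 1 := by nlinarith [abs_pos.2 hb]
  obtain ⟨a₀, A₀, h1, h2, h3, h4, h5, h6, h7⟩ := exists_subalphabet ha hA hN hAa
  obtain ⟨l₀, r₀, h₀⟩ := exists_isEndpoints (b := β') hb1 h3 h4
  obtain ⟨hl, hr⟩ := hB a₀ A₀ l₀ r₀ h5 h6 h7 h₀
  have hc₀ : β < (A₀ : ℝ) - a₀ + 1 := by rw [h5]; push_cast; linarith
  have hAa' : (N : ℝ) ≤ A - a := by exact_mod_cast hAa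
  have h6' : -((N : ℝ) - 1) ≤ a₀ := by exact_mod_cast h6
  have h7' : (A₀ : ℝ) ≤ N - 1 := by exact_mod_cast h7
  have hcov : CoversIoo β β' a₀ A₀ l₀ r₀ := by
    refine coversIoo_of_abs_lt he hβ h hβ' habs hc₀ h₀ (by lia) h6' h7' ht
      fun m n hz hz' hx => ?_
    rcases lt_trichotomy n 0 with hn | hn | hn
    · obtain ⟨h8, h9, h10⟩ := hS (-m) (-n) (by lia) (by push_cast; linarith) (by
        rw [← abs_neg]; convert hx using 2; push_cast; ring)
      exact add_mul_mem_XspecZ_of_abs_le_one β h3 h4 (by lia) (by lia)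
    · subst hn
      have hm : |(m : ℝ)| < 2 := lt_of_lt_of_le (by simpa using hx) ht2
      have hm' : |m| < 2 := by exact_mod_cast hm
      obtain ⟨h8, h9⟩ := abs_lt.1 hm'
      exact add_mul_mem_XspecZ_of_abs_le_one β h3 h4 (by lia) (by lia)
    · obtain ⟨h8, h9, h10⟩ := hS m n (by lia) (by linarith) hx
      exact add_mul_mem_XspecZ_of_abs_le_one β h3 h4 (by lia) (by lia)
  exact CoversIoo.extend he hβ h hβ' habs (by linarith) hend (by lia) (h₀.one_lt hβ habs hc₀)
    fun m n hm hn => XspecZ_mono h1 h2 (hcov m n hm hn)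

theorem coversIoo_of_norm_eq_one {β β' : ℝ} {p a A : ℤ} {l r : ℝ}
    (hβ : 1 < β) (hp : 3 ≤ p) (h : β ^ 2 = p * β - 1) (hβ' : β' = p - β)
    (ha : a ≤ -1) (hA : 1 ≤ A) (hcard : β < (A : ℝ) - a + 1)
    (hend : IsEndpoints β' a A l r) : CoversIoo β β' a A l r := by
  have hp' : (3 : ℝ) ≤ p := by exact_mod_cast hp
  have hprod : β' * β = 1 := by rw [hβ']; linarith
  have hpos : 0 < β' := by
    by_contra! hneg
    nlinarith
  have hlt : β' < 1 := by nlinarith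
  have hAa : p - 1 ≤ A - a := by
    have : (p : ℝ) - 1 < A - a + 1 := by linarith
    have : p - 1 < A - a + 1 := by exact_mod_cast this
    lia
  refine coversIoo_of_bounds (e := 1) (N := p - 1) (t := 1) (B := β - 1) (by norm_num) hβ
    (by simpa using h) hβ' (by rwa [abs_of_pos hpos]) ha hA hend (by lia) hAa
    (by push_cast; linarith) (by push_cast; linarith) ?_ ?_ (by norm_num)
  · intro a₀ A₀ l₀ r₀ h1 h2 h3 h₀
    have h2' : -(((p : ℝ) - 1) - 1) ≤ a₀ := by exact_mod_cast h2
    have h3' : (A₀ : ℝ) ≤ (p - 1) - 1 := by exact_mod_cast h3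
    have hle : β' * l₀ ≤ β' * r₀ := by nlinarith [h₀.neg, h₀.pos]
    have hl := h₀.left
    have hr := h₀.right
    rw [min_eq_left hle] at hl
    rw [max_eq_right hle] at hr
    have hl' : l₀ * (β - 1) = a₀ * β := by linear_combination β * hl + l₀ * hprod
    have hr' : r₀ * (β - 1) = A₀ * β := by linear_combination β * hr + r₀ * hprod
    constructor <;> refine le_of_mul_le_mul_right ?_ (by linarith : 0 < β - 1) <;> nlinarith
  · intro m n hn hz hx
    exfalso
    obtain ⟨-, hx⟩ := abs_lt.1 hx
    rcases hn.eq_or_lt with hn | hn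
    · subst hn
      push_cast at hz hx
      have : (m : ℝ) < 2 - p := by linarith
      have : m < 2 - p := by exact_mod_cast this
      have : m ≤ 1 - p := by lia
      have : (m : ℝ) ≤ 1 - p := by exact_mod_cast this
      linarith
    · have hn' : (2 : ℝ) ≤ n := by exact_mod_cast hn
      nlinarith

theorem coversIoo_of_norm_eq_neg_one {β β' : ℝ} {p a A : ℤ} {l r : ℝ}
    (hβ : 1 < β) (hp : 1 ≤ p) (h : β ^ 2 = p * β + 1) (hβ' : β' = p - β)
    (ha : a ≤ -1) (hA : 1 ≤ A) (hcard : β < (A : ℝ) - a + 1)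
    (hend : IsEndpoints β' a A l r) : CoversIoo β β' a A l r := by
  have hp' : (1 : ℝ) ≤ p := by exact_mod_cast hp
  have hprod : β' * β = -1 := by rw [hβ']; linarith
  have hneg : β' < 0 := by
    by_contra! hpos
    nlinarith
  have hlt : -1 < β' := by nlinarith
  have habs : |β'| * β = 1 := by rw [abs_of_neg hneg]; linarith
  have hAa : p ≤ A - a := by
    have : (p : ℝ) < A - a + 1 := by linarith
    have : p < A - a + 1 := by exact_mod_cast this
    lia
  have hends : ∀ (a₀ A₀ : ℤ) (l₀ r₀ : ℝ), IsEndpoints β' a₀ A₀ l₀ r₀ →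
      l₀ * p = a₀ * β - A₀ ∧ r₀ * p = A₀ * β - a₀ := by
    intro a₀ A₀ l₀ r₀ h₀
    have hle : β' * r₀ ≤ β' * l₀ := by nlinarith [h₀.neg, h₀.pos]
    have hl := h₀.left
    have hr := h₀.right
    rw [min_eq_right hle] at hl
    rw [max_eq_left hle] at hr
    have h1 : l₀ * β = a₀ * β - r₀ := by linear_combination β * hl + r₀ * hprod
    have h2 : r₀ * β = A₀ * β - l₀ := by linear_combination β * hr + l₀ * hprod
    have h0 : β ≠ 0 := by linarith
    constructor <;> refine mul_right_cancel₀ h0 ?_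
    · linear_combination β * h1 - h2 - l₀ * h
    · linear_combination β * h2 - h1 - r₀ * h
  rcases hp.eq_or_lt with hp1 | hp2
  · subst hp1
    push_cast at *
    have hβ1 : 1.6 < β := by nlinarith
    have hβ2 : β < 1.7 := by nlinarith
    refine coversIoo_of_bounds (p := 1) (e := -1) (N := 2) (t := 2) (B := β + 1) (by norm_num) hβ
      (by push_cast; linarith) (by push_cast; exact hβ') habs ha hA hend le_rfl (by lia)
      (by push_cast; linarith) (by push_cast; linarith) ?_ ?_ le_rfl
    · intro a₀ A₀ l₀ r₀ h1 h2 h3 h₀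
      obtain ⟨hl, hr⟩ := hends a₀ A₀ l₀ r₀ h₀
      obtain rfl : a₀ = -1 := by lia
      obtain rfl : A₀ = 1 := by lia
      push_cast at hl hr
      constructor <;> linarith
    · intro m n hn hz hx
      obtain ⟨-, hx⟩ := abs_lt.1 hx
      have hcases : n = 1 ∨ n = 2 ∨ 3 ≤ n := by lia
      rcases hcases with rfl | rfl | hn
      · push_cast at hz hx
        have h1 : (-2 : ℝ) < m := by linarith
        have h2 : (m : ℝ) < 1 := by linarith
        have h1' : -2 < m := by exact_mod_cast h1
        have h2' : m < 1 := by exact_mod_cast h2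
        exact ⟨rfl, by lia, by lia⟩
      · exfalso
        push_cast at hz hx
        have h1 : (m : ℝ) < -1 := by linarith
        have h1' : m < -1 := by exact_mod_cast h1
        have h2 : m ≤ -2 := by lia
        have h2' : (m : ℝ) ≤ -2 := by exact_mod_cast h2
        linarith
      · exfalso
        have hn' : (3 : ℝ) ≤ n := by exact_mod_cast hn
        nlinarith
  · have hp2' : (2 : ℝ) ≤ p := by exact_mod_cast hp2
    refine coversIoo_of_bounds (e := -1) (N := p) (t := 1) (B := β) (by norm_num) hβ
      (by push_cast; linarith) hβ' habs ha hA hend hp2 hAa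
      (by linarith) (by linarith) ?_ ?_ (by norm_num)
    · intro a₀ A₀ l₀ r₀ h1 h2 h3 h₀
      obtain ⟨hl, hr⟩ := hends a₀ A₀ l₀ r₀ h₀
      have h1' : (A₀ : ℝ) = a₀ + p := by exact_mod_cast h1
      have h2' : -((p : ℝ) - 1) ≤ a₀ := by exact_mod_cast h2
      have h3' : (A₀ : ℝ) ≤ p - 1 := by exact_mod_cast h3
      constructor <;> refine le_of_mul_le_mul_right ?_ (by linarith : (0 : ℝ) < p) <;> nlinarith
    · intro m n hn hz hx
      exfalso
      obtain ⟨-, hx⟩ := abs_lt.1 hx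
      rcases hn.eq_or_lt with hn | hn
      · subst hn
        push_cast at hz hx
        have h1 : (m : ℝ) < 1 - p := by linarith
        have h1' : m < 1 - p := by exact_mod_cast h1
        have h2 : m ≤ -p := by lia
        have h2' : (m : ℝ) ≤ -p := by exact_mod_cast h2
        linarith
      · have hn' : (2 : ℝ) ≤ n := by exact_mod_cast hn
        nlinarith

/-- Proposition (positive base case): for a quadratic Pisot unit `β` with conjugate
`β′ = p - β`, an alphabet `𝒜 = {a,…,A}` of consecutive integers with `{-1,0,1} ⊆ 𝒜`
and `#𝒜 > β`, and `γ = 1/β′`, one has `X^𝒜(β) = Σ_β(Ω)` where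
`Ω = interior 𝓘_{γ,𝒜} ∪ {0}`. -/
theorem modified_spectrum_eq_cutProject_pos (β β' : ℝ) (p : ℤ) (a A : ℤ)
    (hβ : 1 < β)
    (hp : (1 ≤ p ∧ β ^ 2 = p * β + 1) ∨ (3 ≤ p ∧ β ^ 2 = p * β - 1))
    (hβ' : β' = (p : ℝ) - β)
    (ha : a ≤ -1) (hA : 1 ≤ A) (hcard : (A : ℝ) - (a : ℝ) + 1 > β) :
    XspecZ β a A = sigmaCP β β' (interior (repInterval (1 / β') a A) ∪ {0}) := by
  obtain ⟨e, he, hq, habs, hcov⟩ : ∃ e : ℤ, e * e = 1 ∧ β ^ 2 = p * β - e ∧ |β'| * β = 1 ∧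
      ∀ l r, IsEndpoints β' a A l r → CoversIoo β β' a A l r := by
    rcases hp with ⟨hp, h⟩ | ⟨hp, h⟩
    · refine ⟨-1, by norm_num, by push_cast; linarith, ?_, fun l r hend =>
        coversIoo_of_norm_eq_neg_one hβ hp h hβ' ha hA hcard hend⟩
      have hprod : β' * β = -1 := by rw [hβ']; linarith
      have h0 := congrArg abs hprod
      rwa [abs_mul, abs_of_pos (by linarith : 0 < β), abs_neg, abs_one] at h0
    · refine ⟨1, by norm_num, by push_cast; linarith, ?_, fun l r hend =>
        coversIoo_of_norm_eq_one hβ hp h hβ' ha hA hcard hend⟩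
      have hprod : β' * β = 1 := by rw [hβ']; linarith
      have h0 := congrArg abs hprod
      rwa [abs_mul, abs_of_pos (by linarith : 0 < β), abs_one] at h0
  have hb : β' ≠ 0 := by rintro h; simp [h] at habs
  have hb1 : |β'| < 1 := by nlinarith [abs_pos.2 hb]
  obtain ⟨l, r, hend⟩ := exists_isEndpoints hb1 ha hA
  rw [hend.interior_repInterval hb hb1 (by lia) (hend.one_lt hβ habs hcard),
    Set.union_eq_left.2 (Set.singleton_subset_iff.2 (Set.mem_Ioo.2 ⟨hend.neg, hend.pos⟩))]
  apply Set.Subset.antisymm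
  · rintro _ ⟨n, c, hc, rfl⟩
    have hq' : β' ^ 2 = p * β' - e := by rw [hβ']; linear_combination hq
    obtain ⟨u, v, hu, hv⟩ := exists_sum_eq_add_mul hq hq' c (n + 1)
    refine ⟨u, v, hu, ?_⟩
    rw [← hv]
    exact hend.sum_mem_Ioo hb (n + 1) c fun j hj => hc j (by lia)
  · rintro _ ⟨m, n, rfl, hz⟩
    exact hcov l r hend m n hz.1 hz.2
end

section
/- Let β be a quadratic Pisot unit, let 𝒜 ∋ 0 be a finite set of consecutive integers with #𝒜 > β, and set γ = −1/β′ where β′ is the Galois conjugate of β. Let Ω be the interior of 𝓘_{γ,𝒜} together with the point 0. Then X^𝒜(−β) = Σ_β(Ω). -/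
section Spectrum

theorem zero_mem_XspecZ {α : ℝ} {a A : ℤ} (ha : a ≤ 0) (hA : 0 ≤ A) : (0 : ℝ) ∈ XspecZ α a A :=
  ⟨0, fun _ => 0, fun _ _ => ⟨ha, hA⟩, by simp⟩

theorem add_mul_mem_XspecZ_s13 {α x : ℝ} {a A d : ℤ} (hd : a ≤ d) (hd' : d ≤ A)
    (hx : x ∈ XspecZ α a A) : (d : ℝ) + α * x ∈ XspecZ α a A := by
  obtain ⟨n, c, hc, rfl⟩ := hx
  refine ⟨n + 1, fun j => Nat.casesOn j d c, ?_, ?_⟩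
  · intro j hj
    cases j with
    | zero => exact ⟨hd, hd'⟩
    | succ j => exact hc j (by omega)
  · rw [Finset.sum_range_succ' _ (n + 1), Finset.mul_sum, add_comm]
    congr 1
    · exact Finset.sum_congr rfl fun j _ => by simp only [pow_succ]; ring
    · simp

theorem neg_mem_XspecZ {α x : ℝ} {a A : ℤ} (hx : x ∈ XspecZ α a A) :
    -x ∈ XspecZ α (-A) (-a) := by
  obtain ⟨n, c, hc, rfl⟩ := hx
  refine ⟨n, fun j => -c j, fun j hj => ?_, by simp⟩
  have := hc j hj
  constructor <;> dsimp only <;> omega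

/-- An induction principle for the spectrum: it is generated from `0` by the maps
`x ↦ d + α x`. -/
theorem XspecZ_induction {α : ℝ} {a A : ℤ} {P : ℝ → Prop} (zero : P 0)
    (step : ∀ (d : ℤ) (x : ℝ), a ≤ d → d ≤ A → P x → P (d + α * x)) {x : ℝ}
    (hx : x ∈ XspecZ α a A) : P x := by
  obtain ⟨n, c, hc, rfl⟩ := hx
  induction n generalizing c with
  | zero => simpa using step (c 0) 0 (hc 0 le_rfl).1 (hc 0 le_rfl).2 zero
  | succ n ih =>
    have h := step (c 0) _ (hc 0 (by omega)).1 (hc 0 (by omega)).2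
      (ih (fun j => c (j + 1)) fun j hj => hc (j + 1) (by omega))
    convert h using 1
    rw [Finset.sum_range_succ' _ (n + 1), Finset.mul_sum, add_comm]
    congr 1
    · simp
    · exact Finset.sum_congr rfl fun j _ => by rw [pow_succ]; ring

end Spectrum

/-- Either some digit moves `z` into `[t, t + 1)`, or an extreme digit leaves it outside. -/
theorem exists_digit (a A : ℤ) (t z : ℝ) :
    (∃ d : ℤ, a ≤ d ∧ d ≤ A ∧ t ≤ z - d ∧ z - d < t + 1) ∨ t + 1 ≤ z - A ∨ z - a < t := by
  by_cases h1 : t + 1 ≤ z - A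
  · exact Or.inr (Or.inl h1)
  by_cases h2 : z - a < t
  · exact Or.inr (Or.inr h2)
  push Not at h1 h2
  refine Or.inl ⟨⌊z - t⌋, ?_, ?_, ?_, ?_⟩
  · exact Int.le_floor.2 (by linarith)
  · exact Int.lt_add_one_iff.1 (Int.floor_lt.2 (by push_cast; linarith))
  · linarith [Int.floor_le (z - t)]
  · linarith [Int.lt_floor_add_one (z - t)]

section RepInterval

variable {γ l r : ℝ} {a A : ℤ}

theorem summable_digits (hγ : 1 < |γ|) {D : ℕ → ℤ} (hD : ∀ i, a ≤ D i ∧ D i ≤ A) :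
    Summable fun i => (D i : ℝ) / γ ^ i := by
  have hs : Summable fun i : ℕ => (|(a : ℝ)| + |(A : ℝ)|) * (|γ|⁻¹) ^ i :=
    (summable_geometric_of_lt_one (by positivity) (inv_lt_one_of_one_lt₀ hγ)).mul_left _
  refine Summable.of_norm_bounded hs fun i => ?_
  rw [Real.norm_eq_abs, abs_div, abs_pow, inv_pow, div_eq_mul_inv]
  refine mul_le_mul_of_nonneg_right ?_ (by positivity)
  have h1 : (a : ℝ) ≤ D i := by exact_mod_cast (hD i).1
  have h2 : (D i : ℝ) ≤ A := by exact_mod_cast (hD i).2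
  rw [abs_le]
  constructor
  · linarith [neg_abs_le (a : ℝ), abs_nonneg (A : ℝ)]
  · linarith [le_abs_self (A : ℝ), abs_nonneg (a : ℝ)]

theorem sum_digits_mem_Icc (hl : l ≤ 0) (hr : 0 ≤ r) (ha : a ≤ 0) (hA : 0 ≤ A)
    (hdiv : ∀ z ∈ Set.Icc (a + l) (A + r), z / γ ∈ Set.Icc l r) (n : ℕ) (D : ℕ → ℤ)
    (hD : ∀ i, a ≤ D i ∧ D i ≤ A) :
    ∑ i ∈ Finset.range n, (D i : ℝ) / γ ^ i ∈ Set.Icc (a + l) (A + r) := by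
  have ha' : (a : ℝ) ≤ 0 := by exact_mod_cast ha
  have hA' : (0 : ℝ) ≤ A := by exact_mod_cast hA
  induction n generalizing D with
  | zero => simp only [Finset.range_zero, Finset.sum_empty]; constructor <;> linarith
  | succ n ih =>
    have h := hdiv _ (ih (fun i => D (i + 1)) fun i => hD (i + 1))
    have h1 : (a : ℝ) ≤ D 0 := by exact_mod_cast (hD 0).1
    have h2 : (D 0 : ℝ) ≤ A := by exact_mod_cast (hD 0).2
    have e : ∑ i ∈ Finset.range (n + 1), (D i : ℝ) / γ ^ i =
        (∑ i ∈ Finset.range n, (D (i + 1) : ℝ) / γ ^ i) / γ + D 0 := by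
      rw [Finset.sum_range_succ', Finset.sum_div]
      congr 1
      · exact Finset.sum_congr rfl fun i _ => by rw [pow_succ, div_div]
      · simp
    rw [e]
    exact ⟨by linarith [h.1], by linarith [h.2]⟩

theorem repInterval_subset_Icc (hγ : 1 < |γ|) (hl : l ≤ 0) (hr : 0 ≤ r) (ha : a ≤ 0) (hA : 0 ≤ A)
    (hdiv : ∀ z ∈ Set.Icc (a + l) (A + r), z / γ ∈ Set.Icc l r) :
    repInterval γ a A ⊆ Set.Icc (a + l) (A + r) := by
  rintro w ⟨D, hD, rfl⟩
  exact isClosed_Icc.mem_of_tendsto (summable_digits hγ hD).hasSum.tendsto_sum_nat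
    (Filter.Eventually.of_forall fun n => sum_digits_mem_Icc hl hr ha hA hdiv n D hD)

theorem Icc_subset_repInterval (hγ : 1 < |γ|) (haA : a ≤ A) (hlr : l + 1 ≤ r)
    (hmul : ∀ w ∈ Set.Icc l r, γ * w ∈ Set.Icc (a + l) (A + r)) :
    Set.Icc (a + l) (A + r) ⊆ repInterval γ a A := by
  intro z hz
  have hγ0 : γ ≠ 0 := by rintro rfl; simp at hγ; linarith
  have key : ∀ z : ℝ, ∃ d : ℤ, z ∈ Set.Icc (a + l) (A + r) →
      (a ≤ d ∧ d ≤ A) ∧ γ * (z - d) ∈ Set.Icc (a + l) (A + r) := by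
    intro z
    by_cases hz : z ∈ Set.Icc (a + l) (A + r)
    · rcases exists_digit a A l z with ⟨d, h1, h2, h3, h4⟩ | h | h
      · exact ⟨d, fun _ => ⟨⟨h1, h2⟩, hmul _ ⟨h3, by linarith⟩⟩⟩
      · exact ⟨A, fun _ => ⟨⟨haA, le_rfl⟩, hmul _ ⟨by linarith, by linarith [hz.2]⟩⟩⟩
      · linarith [hz.1]
    · exact ⟨0, fun h => absurd h hz⟩
  choose d hd using key
  let s : ℕ → ℝ := fun n => (fun z => γ * (z - d z))^[n] z
  have hs_succ : ∀ n, s (n + 1) = γ * (s n - d (s n)) := fun n =>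
    Function.iterate_succ_apply' _ _ _
  have hs : ∀ n, s n ∈ Set.Icc (a + l) (A + r) := by
    intro n
    induction n with
    | zero => exact hz
    | succ n ih => rw [hs_succ]; exact (hd _ ih).2
  have hsum : ∀ n, ∑ i ∈ Finset.range n, (d (s i) : ℝ) / γ ^ i = z - s n / γ ^ n := by
    intro n
    induction n with
    | zero => simp [s]
    | succ n ih =>
      rw [Finset.sum_range_succ, ih, hs_succ]
      field_simp
      ring
  have hD : ∀ i, a ≤ d (s i) ∧ d (s i) ≤ A := fun i => (hd _ (hs i)).1
  refine ⟨fun i => d (s i), hD, ?_⟩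
  have h1 := (summable_digits hγ hD).hasSum.tendsto_sum_nat
  refine tendsto_nhds_unique ?_ h1
  simp only [hsum]
  have h2 : Filter.Tendsto (fun n => s n / γ ^ n) Filter.atTop (nhds 0) := by
    have hp : Filter.Tendsto (fun n : ℕ => (γ⁻¹) ^ n) Filter.atTop (nhds 0) :=
      tendsto_pow_atTop_nhds_zero_of_abs_lt_one (by rw [abs_inv]; exact inv_lt_one_of_one_lt₀ hγ)
    have hb : Filter.IsBoundedUnder (· ≤ ·) Filter.atTop (norm ∘ s) := by
      obtain ⟨C, hC⟩ := (Metric.isBounded_Icc ((a : ℝ) + l) (A + r)).exists_norm_le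
      exact Filter.isBoundedUnder_of ⟨C, fun n => hC _ (hs n)⟩
    have := hp.zero_mul_isBoundedUnder_le hb
    simpa [div_eq_inv_mul] using this
  simpa using h2.const_sub z

end RepInterval

section Dynamics

variable {β β' : ℝ} {p ε a A : ℤ}

theorem eps_sq (hε : ε = 1 ∨ ε = -1) : (ε : ℝ) * ε = 1 := by
  rcases hε with rfl | rfl <;> norm_num

/-- Conjugate of the division step `x + yβ = d - β (x₁ + y₁β)`. -/
theorem conj_step (hε : ε = 1 ∨ ε = -1) (hq : β ^ 2 = p * β + ε) (hβ' : β' = p - β) (u y : ℤ) :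
    ((ε * p * u - y : ℤ) : ℝ) + ((-ε * u : ℤ) : ℝ) * β' = ε * β * (u + y * β') := by
  subst hβ'
  push_cast
  linear_combination (ε * y : ℝ) * hq + (y : ℝ) * eps_sq hε

theorem mem_XspecZ_of_step (hε : ε = 1 ∨ ε = -1) (hq : β ^ 2 = p * β + ε) {x y d : ℤ}
    (hd : a ≤ d) (hd' : d ≤ A)
    (h : ((ε * p * (x - d) - y : ℤ) : ℝ) + ((-ε * (x - d) : ℤ) : ℝ) * β ∈ XspecZ (-β) a A) :
    (x : ℝ) + y * β ∈ XspecZ (-β) a A := by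
  convert add_mul_mem_XspecZ_s13 hd hd' h using 1
  push_cast
  linear_combination (-ε * (x - d) : ℝ) * hq - (x - d : ℝ) * eps_sq hε

/-- Inside an invariant window of length one, the expansion terminates. -/
theorem mem_XspecZ_of_window (hβ : 1 < β) (hε : ε = 1 ∨ ε = -1) (hq : β ^ 2 = p * β + ε)
    (hβ' : β' = p - β) (ha : a ≤ 0) (hA : 0 ≤ A) {t : ℝ} {c : ℤ} (hc : c = 1 ∨ c = -1)
    (hct : ∀ w, t ≤ w → w < t + 1 → -1 < c * w ∧ c * w < 1 - 1 / β)
    (hinv : ∀ w, t ≤ w → w < t + 1 → ∃ d : ℤ, a ≤ d ∧ d ≤ A ∧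
      t ≤ ε * β * w - d ∧ ε * β * w - d < t + 1)
    (u y : ℤ) (h1 : t ≤ u + y * β') (h2 : u + y * β' < t + 1) :
    ((ε * p * u - y : ℤ) : ℝ) + ((-ε * u : ℤ) : ℝ) * β ∈ XspecZ (-β) a A := by
  have hβ0 : 0 < β := by linarith
  set v : ℝ := 1 / β with hv
  have hv0 : 0 < v := by positivity
  have hv1 : v < 1 := (div_lt_one hβ0).2 hβ
  have hβv : β' = -ε * v := by
    rw [hv, hβ']; field_simp; linear_combination -hq
  induction hn : 2 * (-ε * c * y).natAbs + (if 0 < -ε * c * y then 1 else 0)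
    using Nat.strong_induction_on generalizing u y with
  | _ n ih =>
  obtain ⟨hw1, hw2⟩ := hct _ h1 h2
  have hcc : (c : ℝ) * c = 1 := eps_sq hc
  have hee : (ε : ℝ) * ε = 1 := eps_sq hε
  -- the recurrence for the normalised second coordinate
  have hk : ((-ε * c * (-ε * u) : ℤ) : ℝ) = c * (u + y * β') - ((-ε * c * y : ℤ) : ℝ) * v := by
    rw [hβv]; push_cast
    linear_combination (c * u : ℝ) * hee
  by_cases hy : y = 0
  · subst hy
    have hu : u = 0 := by
      simp only [Int.cast_zero, zero_mul, add_zero] at hw1 hw2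
      have e1 : -1 < c * u := by exact_mod_cast hw1
      have e2 : c * u < 1 := by
        have : (c : ℝ) * u < 1 := by linarith
        exact_mod_cast this
      rcases hc with rfl | rfl <;> omega
    subst hu
    simpa using zero_mem_XspecZ ha hA
  · obtain ⟨d, hd1, hd2, hd3, hd4⟩ := hinv _ h1 h2
    rw [← conj_step hε hq hβ'] at hd3 hd4
    refine mem_XspecZ_of_step hε hq hd1 hd2 (ih _ ?_ _ _ ?_ ?_ rfl)
    · rw [← hn]
      have hk0 : -ε * c * y ≠ 0 := by
        rcases hε with rfl | rfl <;> rcases hc with rfl | rfl <;> simpa using hy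
      generalize -ε * c * (-ε * u) = k' at *
      generalize -ε * c * y = k at *
      rcases lt_or_gt_of_ne hk0 with hneg | hpos
      · have hk1 : (k : ℝ) ≤ -1 := by exact_mod_cast (by omega : k ≤ -1)
        have e1 : -1 < k' := by
          have : (-1 : ℝ) < k' := by nlinarith
          exact_mod_cast this
        have e2 : k' < -k := by
          have : (k' : ℝ) < -k := by nlinarith
          exact_mod_cast this
        split_ifs <;> omega
      · have hk1 : (1 : ℝ) ≤ k := by exact_mod_cast hpos
        have e1 : -1 - k < k' := by
          have : (-1 : ℝ) - k < k' := by nlinarith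
          exact_mod_cast this
        have e2 : k' < 1 := by
          have : (k' : ℝ) < 1 := by nlinarith
          exact_mod_cast this
        split_ifs <;> omega
    · push_cast at hd3 ⊢; linarith
    · push_cast at hd4 ⊢; linarith

/-- Every point of the open interval eventually enters the window. -/
theorem mem_XspecZ_of_window_entry (hβ : 1 < β) (hε : ε = 1 ∨ ε = -1) (hq : β ^ 2 = p * β + ε)
    (hβ' : β' = p - β) (ha : a ≤ 0) (hA : 0 ≤ A) {t l r : ℝ} (hlt : l < t + 1) (htr : t ≤ r)
    (hlr : (ε = 1 ∧ β * l = a + l ∧ β * r = A + r ∧ a ≤ (β - 1) * t ∧ (β - 1) * t + β ≤ A + 1) ∨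
      (ε = -1 ∧ -β * r = a + l ∧ -β * l = A + r ∧ -(β + 1) * t < A + 1 ∧
        a ≤ -(β + 1) * t - β))
    (hwin : ∀ u y : ℤ, t ≤ u + y * β' → u + y * β' < t + 1 →
      ((ε * p * u - y : ℤ) : ℝ) + ((-ε * u : ℤ) : ℝ) * β ∈ XspecZ (-β) a A)
    (x y : ℤ) (hL : a + l < x + y * β') (hR : x + y * β' < A + r) :
    (x : ℝ) + y * β ∈ XspecZ (-β) a A := by
  have hβ0 : 0 < β := by linarith
  have haA : a ≤ A := ha.trans hA
  have key : ∀ N : ℕ, ∀ x y : ℤ, a + l < x + y * β' → x + y * β' < A + r →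
      ((a ≤ x + y * β' - t ∧ (A + r) - (a + l) < β ^ N * (A + r - (x + y * β'))) ∨
        (x + y * β' - t < A + 1 ∧ (A + r) - (a + l) < β ^ N * (x + y * β' - (a + l)))) →
      (x : ℝ) + y * β ∈ XspecZ (-β) a A := by
    intro N
    induction N with
    | zero =>
      rintro x y hL hR (⟨-, h⟩ | ⟨-, h⟩) <;> rw [pow_zero, one_mul] at h <;> linarith
    | succ N ih =>
      intro x y hL hR h
      set z : ℝ := x + y * β' with hz
      have hnext : ∀ d : ℤ, ((ε * p * (x - d) - y : ℤ) : ℝ) + ((-ε * (x - d) : ℤ) : ℝ) * β' =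
          ε * β * (z - d) := by
        intro d
        rw [conj_step hε hq hβ', hz]; push_cast; ring
      rcases exists_digit a A t z with ⟨d, h1, h2, h3, h4⟩ | h' | h'
      · refine mem_XspecZ_of_step hε hq h1 h2 (hwin _ _ ?_ ?_)
        · push_cast; linarith
        · push_cast; linarith
      · have h : (A + r) - (a + l) < β ^ (N + 1) * (A + r - z) := by
          rcases h with h | h
          · exact h.2
          · linarith [h.1]
        rw [pow_succ, mul_assoc] at h
        have hw : β * (z - A) < β * r := mul_lt_mul_of_pos_left (by linarith) hβ0
        have hw' : β * l < β * (z - A) := mul_lt_mul_of_pos_left (by linarith) hβ0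
        have hw'' : β * (t + 1) ≤ β * (z - A) := mul_le_mul_of_nonneg_left h' hβ0.le
        refine mem_XspecZ_of_step hε hq haA le_rfl (ih _ _ ?_ ?_ ?_) <;> rw [hnext]
        · rcases hlr with ⟨rfl, e1, e2, e3, e4⟩ | ⟨rfl, e1, e2, e3, e4⟩ <;> push_cast <;> linarith
        · rcases hlr with ⟨rfl, e1, e2, e3, e4⟩ | ⟨rfl, e1, e2, e3, e4⟩ <;> push_cast <;> linarith
        · rcases hlr with ⟨rfl, e1, e2, e3, e4⟩ | ⟨rfl, e1, e2, e3, e4⟩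
          · refine Or.inl ⟨by push_cast; linarith, ?_⟩
            convert h using 2
            push_cast; linarith
          · refine Or.inr ⟨by push_cast; linarith, ?_⟩
            convert h using 2
            push_cast; linarith
      · have h : (A + r) - (a + l) < β ^ (N + 1) * (z - (a + l)) := by
          have haA' : (a : ℝ) ≤ A := by exact_mod_cast haA
          rcases h with h | h
          · linarith [h.1]
          · exact h.2
        rw [pow_succ, mul_assoc] at h
        have hw : β * (z - a) < β * r := mul_lt_mul_of_pos_left (by linarith) hβ0
        have hw' : β * l < β * (z - a) := mul_lt_mul_of_pos_left (by linarith) hβ0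
        have hw'' : β * (z - a) < β * t := mul_lt_mul_of_pos_left h' hβ0
        refine mem_XspecZ_of_step hε hq le_rfl haA (ih _ _ ?_ ?_ ?_) <;> rw [hnext]
        · rcases hlr with ⟨rfl, e1, e2, e3, e4⟩ | ⟨rfl, e1, e2, e3, e4⟩ <;> push_cast <;> linarith
        · rcases hlr with ⟨rfl, e1, e2, e3, e4⟩ | ⟨rfl, e1, e2, e3, e4⟩ <;> push_cast <;> linarith
        · rcases hlr with ⟨rfl, e1, e2, e3, e4⟩ | ⟨rfl, e1, e2, e3, e4⟩
          · refine Or.inr ⟨by push_cast; linarith, ?_⟩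
            convert h using 2
            push_cast; linarith
          · refine Or.inl ⟨by push_cast; linarith, ?_⟩
            convert h using 2
            push_cast; linarith
  have hpow : ∀ δ : ℝ, 0 < δ → ∃ N : ℕ, (A + r) - (a + l) < β ^ N * δ := by
    intro δ hδ
    obtain ⟨N, hN⟩ := pow_unbounded_of_one_lt (((A + r) - (a + l)) / δ) hβ
    exact ⟨N, (div_lt_iff₀ hδ).1 hN⟩
  have haA' : (a : ℝ) ≤ A := by exact_mod_cast haA
  by_cases hlo : (a : ℝ) ≤ x + y * β' - t
  · obtain ⟨N, hN⟩ := hpow (A + r - (x + y * β')) (by linarith)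
    exact key N x y hL hR (Or.inl ⟨hlo, hN⟩)
  · obtain ⟨N, hN⟩ := hpow (x + y * β' - (a + l)) (by linarith)
    exact key N x y hL hR (Or.inr ⟨by linarith, hN⟩)

/-- A window with good numerical properties yields all of `Ω`. -/
theorem mem_XspecZ_of_good_window (hβ : 1 < β) (hε : ε = 1 ∨ ε = -1) (hq : β ^ 2 = p * β + ε)
    (hβ' : β' = p - β) (ha : a ≤ 0) (hA : 0 ≤ A) {t l r : ℝ} (hl : l ≤ 0) (hr : 0 ≤ r)
    (ht : t ≤ 0) (ht1 : -1 < t) (htc : -1 + 1 / β < t ∨ t ≤ -(1 / β))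
    (hlr : (ε = 1 ∧ β * l = a + l ∧ β * r = A + r ∧ a ≤ (β - 1) * t ∧ (β - 1) * t + β ≤ A + 1) ∨
      (ε = -1 ∧ -β * r = a + l ∧ -β * l = A + r ∧ -(β + 1) * t < A + 1 ∧
        a ≤ -(β + 1) * t - β))
    (x y : ℤ) (hz : (a + l < x + y * β' ∧ x + y * β' < A + r) ∨ x + y * β' = 0) :
    (x : ℝ) + y * β ∈ XspecZ (-β) a A := by
  have hβ0 : 0 < β := by linarith
  obtain ⟨c, hc, hct⟩ : ∃ c : ℤ, (c = 1 ∨ c = -1) ∧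
      ∀ w, t ≤ w → w < t + 1 → -1 < c * w ∧ c * w < 1 - 1 / β := by
    rcases htc with h | h
    · exact ⟨-1, Or.inr rfl, fun w h1 h2 => ⟨by push_cast; linarith, by push_cast; linarith⟩⟩
    · exact ⟨1, Or.inl rfl, fun w h1 h2 => ⟨by push_cast; linarith, by push_cast; linarith⟩⟩
  have hwin := mem_XspecZ_of_window (p := p) hβ hε hq hβ' ha hA hc hct (by
    intro w h1 h2
    have e5 : β * t ≤ β * w := mul_le_mul_of_nonneg_left h1 hβ0.le
    have e6 : β * w < β * (t + 1) := mul_lt_mul_of_pos_left h2 hβ0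
    rcases exists_digit a A t (ε * β * w) with h | h | h
    · exact h
    · rcases hlr with ⟨rfl, e1, e2, e3, e4⟩ | ⟨rfl, e1, e2, e3, e4⟩ <;> push_cast at h <;> linarith
    · rcases hlr with ⟨rfl, e1, e2, e3, e4⟩ | ⟨rfl, e1, e2, e3, e4⟩ <;> push_cast at h <;> linarith)
  rcases hz with ⟨hL, hR⟩ | h0
  · exact mem_XspecZ_of_window_entry hβ hε hq hβ' ha hA (by linarith) (by linarith) hlr hwin
      x y hL hR
  · refine mem_XspecZ_of_step (d := 0) hε hq ha hA (hwin _ _ ?_ ?_) <;>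
      rw [sub_zero, h0] <;> linarith

/-- Finite expansions have conjugates inside the open interval, unless they vanish. -/
theorem exists_conj_of_mem_XspecZ (hq : β ^ 2 = p * β + ε)
    (hβ' : β' = p - β) (ha : a ≤ 0) (hA : 0 ≤ A) {l r : ℝ} (hl : l ≤ 0) (hr : 0 ≤ r)
    (hal : a < 0 → l < 0)
    (hAr : 0 < A → 0 < r)
    (hdiv : ∀ z ∈ Set.Ioo (a + l) (A + r), -β' * z ∈ Set.Ioo l r)
    {ξ : ℝ} (hξ : ξ ∈ XspecZ (-β) a A) :
    ∃ x y : ℤ, ξ = x + y * β ∧ ((x = 0 ∧ y = 0) ∨ (x : ℝ) + y * β' ∈ Set.Ioo (a + l) (A + r)) := by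
  refine XspecZ_induction (α := -β) (P := fun ξ => ∃ x y : ℤ, ξ = x + y * β ∧
    ((x = 0 ∧ y = 0) ∨ (x : ℝ) + y * β' ∈ Set.Ioo (a + l) (A + r))) ⟨0, 0, by simp⟩ ?_ hξ
  rintro d _ hd1 hd2 ⟨x, y, rfl, h⟩
  refine ⟨d - ε * y, -x - p * y, ?_, ?_⟩
  · push_cast
    linear_combination (-y : ℝ) * hq
  · rcases h with ⟨rfl, rfl⟩ | h
    · by_cases hd : d = 0
      · left; simp [hd]
      · right
        simp only [mul_zero, sub_zero, neg_zero, Int.cast_zero, zero_mul, add_zero]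
        constructor
        · rcases hd1.lt_or_eq with h | rfl
          · have : (a : ℝ) < d := by exact_mod_cast h
            linarith
          · linarith [hal (lt_of_le_of_ne ha hd)]
        · rcases hd2.lt_or_eq with h | rfl
          · have : (d : ℝ) < A := by exact_mod_cast h
            linarith
          · linarith [hAr (lt_of_le_of_ne hA (Ne.symm hd))]
    · right
      have h1 : (a : ℝ) ≤ d := by exact_mod_cast hd1
      have h2 : (d : ℝ) ≤ A := by exact_mod_cast hd2
      have e : ((d - ε * y : ℤ) : ℝ) + ((-x - p * y : ℤ) : ℝ) * β' = d + -β' * (x + y * β') := by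
        subst hβ'
        push_cast
        linear_combination (y : ℝ) * hq
      rw [e]
      exact ⟨by linarith [(hdiv _ h).1], by linarith [(hdiv _ h).2]⟩

theorem XspecZ_eq_sigmaCP (hβ : 1 < β) (hε : ε = 1 ∨ ε = -1) (hq : β ^ 2 = p * β + ε)
    (hβ' : β' = p - β) (ha : a ≤ 0) (hA : 0 ≤ A) {l r : ℝ} (hl : l ≤ 0) (hr : 0 ≤ r)
    (hal : a < 0 → l < 0) (hAr : 0 < A → 0 < r) (hlr1 : l + 1 ≤ r)
    (hlr : (ε = 1 ∧ β * l = a + l ∧ β * r = A + r) ∨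
      (ε = -1 ∧ -β * r = a + l ∧ -β * l = A + r))
    (hmem : ∀ x y : ℤ, (a + l < x + y * β' ∧ x + y * β' < A + r) ∨ x + y * β' = 0 →
      (x : ℝ) + y * β ∈ XspecZ (-β) a A) :
    XspecZ (-β) a A = sigmaCP β β' (interior (repInterval (-1 / β') a A) ∪ {0}) := by
  have hβ0 : 0 < β := by linarith
  have hββ' : β * β' = -ε := by rw [hβ']; linear_combination -hq
  have hee : (ε : ℝ) * ε = 1 := eps_sq hε
  have hβ'0 : β' ≠ 0 := by
    rintro h
    rw [h, mul_zero] at hββ'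
    nlinarith
  have hγ : -1 / β' = ε * β := by
    rw [div_eq_iff hβ'0]
    linear_combination (-ε : ℝ) * hββ' + hee
  have hγ1 : 1 < |(ε : ℝ) * β| := by
    rw [abs_mul, abs_of_pos hβ0]
    rcases hε with rfl | rfl <;> simpa using hβ
  have hmul : ∀ w ∈ Set.Icc l r, (ε : ℝ) * β * w ∈ Set.Icc (a + l) (A + r) := by
    intro w hw
    have e1 := mul_le_mul_of_nonneg_left hw.1 hβ0.le
    have e2 := mul_le_mul_of_nonneg_left hw.2 hβ0.le
    rcases hlr with ⟨rfl, e3, e4⟩ | ⟨rfl, e3, e4⟩ <;> push_cast <;> constructor <;> linarith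
  have hdiv : ∀ z ∈ Set.Icc (a + l) (A + r), z / (ε * β) ∈ Set.Icc l r := by
    intro z hz
    rcases hlr with ⟨rfl, e3, e4⟩ | ⟨rfl, e3, e4⟩
    · rw [Int.cast_one, one_mul, Set.mem_Icc, le_div_iff₀ hβ0, div_le_iff₀ hβ0]
      constructor <;> linarith [hz.1, hz.2]
    · rw [Int.cast_neg, Int.cast_one, neg_one_mul, div_neg, Set.mem_Icc, le_neg, neg_le,
        le_div_iff₀ hβ0, div_le_iff₀ hβ0]
      constructor <;> linarith [hz.1, hz.2]
  have hdiv' : ∀ z ∈ Set.Ioo (a + l) (A + r), -β' * z ∈ Set.Ioo l r := by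
    intro z hz
    have e : β * (-β' * z) = ε * z := by linear_combination -z * hββ'
    constructor <;> refine lt_of_mul_lt_mul_left ?_ hβ0.le <;> rw [e] <;>
      rcases hlr with ⟨rfl, e3, e4⟩ | ⟨rfl, e3, e4⟩ <;> push_cast <;> linarith [hz.1, hz.2]
  have hrep : repInterval (-1 / β') a A = Set.Icc (a + l) (A + r) := by
    rw [hγ]
    exact (repInterval_subset_Icc hγ1 hl hr ha hA hdiv).antisymm
      (Icc_subset_repInterval hγ1 (ha.trans hA) hlr1 hmul)
  rw [hrep, interior_Icc]
  ext ξ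
  constructor
  · intro hξ
    obtain ⟨x, y, h1, h2⟩ := exists_conj_of_mem_XspecZ hq hβ' ha hA hl hr hal hAr hdiv' hξ
    refine ⟨x, y, h1, ?_⟩
    rcases h2 with ⟨rfl, rfl⟩ | h2
    · right; simp
    · exact Or.inl h2
  · rintro ⟨x, y, rfl, h⟩
    exact hmem x y h

/-- The unit of norm `-1` when the positive part of the alphabet dominates. -/
theorem mem_XspecZ_norm_neg_one (hβ : 1 < β) (hq : β ^ 2 = p * β + 1) (hβ' : β' = p - β)
    (ha : a ≤ 0) (hA : 0 ≤ A) (hcard : β < A - a + 1) (haA : -a ≤ A) {l r : ℝ}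
    (hl : l = a / (β - 1)) (hr : r = A / (β - 1)) (x y : ℤ)
    (hz : (a + l < x + y * β' ∧ x + y * β' < A + r) ∨ x + y * β' = 0) :
    (x : ℝ) + y * β ∈ XspecZ (-β) a A := by
  have hβ0 : 0 < β := by linarith
  have hβ1 : 0 < β - 1 := by linarith
  have ha' : (a : ℝ) ≤ 0 := by exact_mod_cast ha
  have haA' : -(a : ℝ) ≤ A := by exact_mod_cast haA
  have hl' : (β - 1) * l = a := by rw [hl]; field_simp
  have hr' : (β - 1) * r = A := by rw [hr]; field_simp
  have hA1 : (1 : ℝ) ≤ A := by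
    have : 0 < A := by
      have : (0 : ℝ) < A := by linarith
      exact_mod_cast this
    exact_mod_cast this
  have hl0 : l ≤ 0 := by nlinarith
  have hr0 : 0 < r := by nlinarith
  have hr2 : 1 / 2 < r := by nlinarith
  have hlr1 : l < r - 1 := by nlinarith
  have hv : 1 / β < 1 := (div_lt_one hβ0).2 hβ
  have hq' : β ^ 2 = p * β + ((1 : ℤ) : ℝ) := by rw [hq]; norm_num
  by_cases h1 : 1 ≤ r
  · refine mem_XspecZ_of_good_window (t := 0) (l := l) (r := r) (ε := 1) hβ (Or.inl rfl) hq' hβ'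
      ha hA hl0 hr0.le le_rfl (by norm_num) (Or.inl (by linarith))
      (Or.inl ⟨rfl, by linarith, by linarith, by linarith, by nlinarith⟩) x y hz
  · push Not at h1
    have hβ2 : 2 < β := by nlinarith
    have hv2 : 1 / β < 1 / 2 := one_div_lt_one_div_of_lt (by norm_num) hβ2
    refine mem_XspecZ_of_good_window (t := r - 1) (l := l) (r := r) (ε := 1) hβ (Or.inl rfl) hq'
      hβ' ha hA hl0 hr0.le (by linarith) (by linarith) (Or.inl (by linarith))
      (Or.inl ⟨rfl, by linarith, by linarith, by nlinarith, by nlinarith⟩) x y hz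

theorem mem_XspecZ_norm_one (hβ : 2 < β) (hq : β ^ 2 = p * β - 1) (hβ' : β' = p - β)
    (ha : a ≤ 0) (hA : 0 ≤ A) (hcard : β < A - a + 1) {l r : ℝ} (hl : l ≤ 0) (hr : 0 ≤ r)
    (hl' : -β * r = a + l) (hr' : -β * l = A + r) (x y : ℤ)
    (hz : (a + l < x + y * β' ∧ x + y * β' < A + r) ∨ x + y * β' = 0) :
    (x : ℝ) + y * β ∈ XspecZ (-β) a A := by
  have ha' : (a : ℝ) ≤ 0 := by exact_mod_cast ha
  have hA' : (0 : ℝ) ≤ A := by exact_mod_cast hA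
  have hv2 : 1 / β < 1 / 2 := one_div_lt_one_div_of_lt (by norm_num) hβ
  have hq' : β ^ 2 = p * β + ((-1 : ℤ) : ℝ) := by rw [hq]; push_cast; ring
  have good : ∀ t : ℝ, t ≤ 0 → -1 < t → -(β + 1) * t < A + 1 → a ≤ -(β + 1) * t - β →
      (x : ℝ) + y * β ∈ XspecZ (-β) a A := fun t h1 h2 h3 h4 =>
    mem_XspecZ_of_good_window (by linarith) (Or.inr rfl) hq' hβ' ha hA hl hr h1 h2
      (by by_cases h : -1 + 1 / β < t
          · exact Or.inl h
          · exact Or.inr (by linarith))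
      (Or.inr ⟨rfl, hl', hr', h3, h4⟩) x y hz
  by_cases h : 0 ≤ a + β
  · have e : (β + 1) * (-(a + β) / (β + 1)) = -(a + β) := by field_simp
    refine good (-(a + β) / (β + 1)) ?_ ?_ ?_ ?_
    · exact div_nonpos_of_nonpos_of_nonneg (by linarith) (by linarith)
    · rw [lt_div_iff₀ (by linarith)]; linarith
    · linarith
    · linarith
  · exact good 0 le_rfl (by norm_num) (by linarith) (by linarith)

end Dynamics

/-- Proposition (negative base case): for a quadratic Pisot unit `β` with conjugate
`β′ = p - β`, an alphabet `𝒜 = {a,…,A} ∋ 0` of consecutive integers with `#𝒜 > β`,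
and `γ = -1/β′`, one has `X^𝒜(-β) = Σ_β(Ω)` where `Ω = interior 𝓘_{γ,𝒜} ∪ {0}`. -/
theorem modified_spectrum_eq_cutProject_neg (β β' : ℝ) (p : ℤ) (a A : ℤ)
    (hβ : 1 < β)
    (hp : (1 ≤ p ∧ β ^ 2 = p * β + 1) ∨ (3 ≤ p ∧ β ^ 2 = p * β - 1))
    (hβ' : β' = (p : ℝ) - β)
    (ha : a ≤ 0) (hA : 0 ≤ A) (hcard : (A : ℝ) - (a : ℝ) + 1 > β) :
    XspecZ (-β) a A = sigmaCP β β' (interior (repInterval (-1 / β') a A) ∪ {0}) := by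
  have ha' : (a : ℝ) ≤ 0 := by exact_mod_cast ha
  have hA' : (0 : ℝ) ≤ A := by exact_mod_cast hA
  have hβ1 : 0 < β - 1 := by linarith
  rcases hp with ⟨-, hq⟩ | ⟨hp3, hq⟩
  · have hl' : (β - 1) * (a / (β - 1)) = a := by field_simp
    have hr' : (β - 1) * (A / (β - 1)) = A := by field_simp
    refine XspecZ_eq_sigmaCP (ε := 1) (l := a / (β - 1)) (r := A / (β - 1)) hβ (Or.inl rfl)
      (by rw [hq]; norm_num) hβ' ha hA (div_nonpos_of_nonpos_of_nonneg ha' hβ1.le)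
      (div_nonneg hA' hβ1.le) (fun h => div_neg_of_neg_of_pos (by exact_mod_cast h) hβ1)
      (fun h => div_pos (by exact_mod_cast h) hβ1) (by nlinarith)
      (Or.inl ⟨rfl, by linarith, by linarith⟩) fun x y hz => ?_
    rcases le_total (-a) A with h | h
    · exact mem_XspecZ_norm_neg_one hβ hq hβ' ha hA hcard h rfl rfl x y hz
    · have key := neg_mem_XspecZ (mem_XspecZ_norm_neg_one (a := -A) (A := -a) hβ hq hβ' (by omega)
        (by omega) (by push_cast; linarith) (by omega) rfl rfl (-x) (-y) (by
          push_cast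
          rw [neg_div, neg_div]
          rcases hz with ⟨h1, h2⟩ | h1
          · left; constructor <;> linarith
          · right; linarith))
      rw [neg_neg, neg_neg] at key
      convert key using 1
      push_cast; ring
  · have hp3' : (3 : ℝ) ≤ p := by exact_mod_cast hp3
    have hβ2 : 2 < β := by nlinarith
    have hD : 0 < β ^ 2 - 1 := by nlinarith
    have hl' : (β ^ 2 - 1) * ((a - A * β) / (β ^ 2 - 1)) = a - A * β := by field_simp
    have hr' : (β ^ 2 - 1) * ((A - a * β) / (β ^ 2 - 1)) = A - a * β := by field_simp
    have hs : -β * ((A - a * β) / (β ^ 2 - 1)) = a + (a - A * β) / (β ^ 2 - 1) := by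
      field_simp; ring
    have hs' : -β * ((a - A * β) / (β ^ 2 - 1)) = A + (A - a * β) / (β ^ 2 - 1) := by
      field_simp; ring
    have hl0 : (a - A * β) / (β ^ 2 - 1) < 0 := div_neg_of_neg_of_pos (by nlinarith) hD
    have hr0 : 0 < (A - a * β) / (β ^ 2 - 1) := div_pos (by nlinarith) hD
    exact XspecZ_eq_sigmaCP (ε := -1) hβ (Or.inr rfl) (by rw [hq]; push_cast; ring) hβ' ha hA
      hl0.le hr0.le (fun _ => hl0) (fun _ => hr0) (by nlinarith) (Or.inr ⟨rfl, hs, hs'⟩)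
      (mem_XspecZ_norm_one hβ2 hq hβ' ha hA hcard hl0.le hr0.le hs hs')
end
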